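/- arXiv:2511.09673 — 10 statements merged into one kernel-verified Lean document; each statement's English description precedes it below -/
import Mathlib

section
/- Let −1/2 ≤ z₁′ ≤ z₁ ≤ z₂ ≤ z₂′ ≤ 1/2. Then the 1-angular distances satisfy θ(z₁, z₂) ≥ θ(z₁′, z₂′); that is, as the vertical distance between two heights decreases, the 1-angular distance increases. -/
/-- The Petty norm on ℝ³: ‖(x,y,z)‖ = √(x²+y²) + |z|. -/
noncomputable def pettyNorm (a : ℝ × ℝ × ℝ) : ℝ :=
  Real.sqrt (a.1 ^ 2 + a.2.1 ^ 2) + |a.2.2|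

/-- The Petty distance on ℝ³. -/
noncomputable def pettyDist (a b : ℝ × ℝ × ℝ) : ℝ := pettyNorm (a - b)

/-- The unit sphere of the Petty space. -/
def pettySphere : Set (ℝ × ℝ × ℝ) := {a | pettyNorm a = 1}

/-- A set is 1-separated if all pairwise Petty distances are ≥ 1. -/
def OneSeparated (S : Set (ℝ × ℝ × ℝ)) : Prop :=
  ∀ a ∈ S, ∀ b ∈ S, a ≠ b → 1 ≤ pettyDist a b

/-- The 1-angular distance of two heights z₁, z₂. -/
noncomputable def oneAngularDist (z₁ z₂ : ℝ) : ℝ :=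
  Real.arccos (((1 - |z₁|) ^ 2 + (1 - |z₂|) ^ 2 - (1 - |z₁ - z₂|) ^ 2) /
    (2 * (1 - |z₁|) * (1 - |z₂|)))

/-- Reflecting both heights in the equatorial plane preserves the 1-angular distance. -/
theorem oneAngularDist_neg_neg (u v : ℝ) : oneAngularDist (-v) (-u) = oneAngularDist u v := by
  unfold oneAngularDist
  rw [abs_neg, abs_neg, show -v - -u = u - v by ring]
  congr 1
  ring

/-- Monotonicity in the upper height, when it stays in the lower half-space. -/
theorem oneAngularDist_le_of_nonpos {u v w : ℝ} (hu : -(1/2) ≤ u) (huv : u ≤ v) (hvw : v ≤ w)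
    (hw : w ≤ 0) : oneAngularDist u w ≤ oneAngularDist u v := by
  unfold oneAngularDist
  apply Real.arccos_le_arccos
  rw [abs_of_nonpos (by linarith : u ≤ 0), abs_of_nonpos (by linarith : v ≤ 0), abs_of_nonpos hw,
    abs_of_nonpos (by linarith : u - v ≤ 0), abs_of_nonpos (by linarith : u - w ≤ 0)]
  simp only [sub_neg_eq_add]
  have ha : 0 < 1 + u := by linarith
  have hb : 0 < 1 + v := by linarith
  have hc : 0 < 1 + w := by linarith
  rw [← sub_nonneg]
  have key : 0 ≤ (w - v) * (2 * (1 + u) + 1) / (2 * (1 + u) * (1 + v) * (1 + w)) :=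
    div_nonneg (mul_nonneg (by linarith) (by linarith)) (by positivity)
  convert key using 1
  field_simp
  ring

/-- Monotonicity in the upper height, when it stays in the upper half-space. -/
theorem oneAngularDist_le_of_nonneg {u v w : ℝ} (hu : -(1/2) ≤ u) (huv : u ≤ v) (hv : 0 ≤ v)
    (hvw : v ≤ w) (hw : w ≤ 1/2) : oneAngularDist u w ≤ oneAngularDist u v := by
  unfold oneAngularDist
  apply Real.arccos_le_arccos
  rw [abs_of_nonneg hv, abs_of_nonneg (by linarith : 0 ≤ w),
    abs_of_nonpos (by linarith : u - v ≤ 0), abs_of_nonpos (by linarith : u - w ≤ 0)]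
  have hu' : |u| ≤ 1/2 := abs_le.2 ⟨hu, by linarith⟩
  have ha : 0 < 1 - |u| := by linarith
  have hb : 0 < 1 - v := by linarith
  have hc : 0 < 1 - w := by linarith
  rw [← sub_nonneg]
  have key : 0 ≤ (w - v) * (2 * (1 - |u|) - 1) / (2 * (1 - |u|) * (1 - v) * (1 - w)) :=
    div_nonneg (mul_nonneg (by linarith) (by linarith)) (by positivity)
  convert key using 1
  rcases abs_cases u with ⟨h, -⟩ | ⟨h, -⟩ <;> rw [h] at ha ⊢ <;> field_simp <;> ring

/-- The 1-angular distance decreases as the upper height increases. -/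
theorem oneAngularDist_le_of_le_right {u v w : ℝ} (hu : -(1/2) ≤ u) (huv : u ≤ v) (hvw : v ≤ w)
    (hw : w ≤ 1/2) : oneAngularDist u w ≤ oneAngularDist u v := by
  rcases le_total 0 v with hv | hv
  · exact oneAngularDist_le_of_nonneg hu huv hv hvw hw
  rcases le_total w 0 with hw' | hw'
  · exact oneAngularDist_le_of_nonpos hu huv hvw hw'
  · exact (oneAngularDist_le_of_nonneg hu (huv.trans hv) le_rfl hw' hw).trans
      (oneAngularDist_le_of_nonpos hu huv hv le_rfl)

/-- If −1/2 ≤ z₁′ ≤ z₁ ≤ z₂ ≤ z₂′ ≤ 1/2 then θ(z₁, z₂) ≥ θ(z₁′, z₂′). -/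
theorem oneAngularDist_anti (z₁' z₁ z₂ z₂' : ℝ)
    (h₁ : -(1/2) ≤ z₁') (h₂ : z₁' ≤ z₁) (h₃ : z₁ ≤ z₂) (h₄ : z₂ ≤ z₂') (h₅ : z₂' ≤ 1/2) :
    oneAngularDist z₁ z₂ ≥ oneAngularDist z₁' z₂' := by
  have upper : oneAngularDist z₁' z₂' ≤ oneAngularDist z₁' z₂ :=
    oneAngularDist_le_of_le_right h₁ (h₂.trans h₃) h₄ h₅
  have lower : oneAngularDist (-z₂) (-z₁') ≤ oneAngularDist (-z₂) (-z₁) :=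
    oneAngularDist_le_of_le_right (by linarith) (by linarith) (by linarith) (by linarith)
  rw [oneAngularDist_neg_neg, oneAngularDist_neg_neg] at lower
  exact upper.trans lower
end

section
/- Let n ≥ 2 and let S = {a₁, …, aₙ} be a 1-separated set of n distinct points of the unit sphere S_X of the Petty space, written in regular form: aₖ = (rₖ·cos θₖ, rₖ·sin θₖ, zₖ) with rₖ = 1 − |zₖ|, −1/2 ≤ zₖ ≤ 1/2 for all k, and 0 ≤ θ₁ ≤ θ₂ ≤ … ≤ θₙ < 2π. Then the sum of the 1-angular distances of consecutive points satisfies Σ_{k=1}^{n−1} θ(zₖ, z_{k+1}) + θ(zₙ, z₁) ≤ 2π. -/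
/-- The law of cosines turns 1-separation of two points of the Petty sphere into an upper bound
for the cosine of the angle between their horizontal parts. -/
theorem cos_sub_le_of_one_le_pettyDist {z₁ z₂ t₁ t₂ : ℝ} (h₁ : |z₁| < 1) (h₂ : |z₂| < 1)
    (h : |z₁ - z₂| ≤ 1)
    (hd : 1 ≤ pettyDist ((1 - |z₁|) * Real.cos t₁, (1 - |z₁|) * Real.sin t₁, z₁)
      ((1 - |z₂|) * Real.cos t₂, (1 - |z₂|) * Real.sin t₂, z₂)) :
    Real.cos (t₂ - t₁) ≤ ((1 - |z₁|) ^ 2 + (1 - |z₂|) ^ 2 - (1 - |z₁ - z₂|) ^ 2) /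
      (2 * (1 - |z₁|) * (1 - |z₂|)) := by
  have hr₁ : 0 < 1 - |z₁| := by linarith
  have hr₂ : 0 < 1 - |z₂| := by linarith
  simp only [pettyDist, pettyNorm, Prod.fst_sub, Prod.snd_sub] at hd
  have hsq := (Real.le_sqrt (sub_nonneg.2 h) (by positivity)).1 (sub_le_iff_le_add.2 hd)
  rw [le_div_iff₀ (by positivity), Real.cos_sub]
  linear_combination hsq + (1 - |z₁|) ^ 2 * Real.sin_sq_add_cos_sq t₁ +
    (1 - |z₂|) ^ 2 * Real.sin_sq_add_cos_sq t₂

/-- If `0 ≤ t` and `cos t ≤ c`, then `arccos c ≤ t`. -/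
theorem arccos_le_of_cos_le {c t : ℝ} (ht : 0 ≤ t) (h : Real.cos t ≤ c) : Real.arccos c ≤ t := by
  rcases le_total t Real.pi with hπ | hπ
  · simpa only [Real.arccos_cos ht hπ] using Real.arccos_le_arccos h
  · exact (Real.arccos_le_pi c).trans hπ

/-- a 1-separated set of n ≥ 2 points of the Petty unit sphere in regular form
has total consecutive 1-angular distance at most 2π. -/
theorem sum_oneAngularDist_le_two_pi (n : ℕ) (hn : 2 ≤ n) (z θ : ℕ → ℝ)
    (a : ℕ → ℝ × ℝ × ℝ)
    (ha : ∀ k < n, a k = ((1 - |z k|) * Real.cos (θ k), (1 - |z k|) * Real.sin (θ k), z k))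
    (hz : ∀ k < n, -(1/2) ≤ z k ∧ z k ≤ 1/2)
    (hθ0 : 0 ≤ θ 0) (hθmono : ∀ i j, i ≤ j → j < n → θ i ≤ θ j)
    (hθlast : θ (n - 1) < 2 * Real.pi)
    (hinj : ∀ i < n, ∀ j < n, i ≠ j → a i ≠ a j)
    (hsep : ∀ i < n, ∀ j < n, i ≠ j → 1 ≤ pettyDist (a i) (a j)) :
    (∑ k ∈ Finset.range (n - 1), oneAngularDist (z k) (z (k + 1))) +
      oneAngularDist (z (n - 1)) (z 0) ≤ 2 * Real.pi := by
  have hcos : ∀ i < n, ∀ j < n, i ≠ j → Real.cos (θ j - θ i) ≤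
      ((1 - |z i|) ^ 2 + (1 - |z j|) ^ 2 - (1 - |z i - z j|) ^ 2) /
        (2 * (1 - |z i|) * (1 - |z j|)) := by
    intro i hi j hj hij
    obtain ⟨hi₁, hi₂⟩ := hz i hi
    obtain ⟨hj₁, hj₂⟩ := hz j hj
    have hd := hsep i hi j hj hij
    rw [ha i hi, ha j hj] at hd
    refine cos_sub_le_of_one_le_pettyDist ?_ ?_ ?_ hd
    · rw [abs_lt]; constructor <;> linarith
    · rw [abs_lt]; constructor <;> linarith
    · rw [abs_le]; constructor <;> linarith
  have hsum : ∑ k ∈ Finset.range (n - 1), oneAngularDist (z k) (z (k + 1)) ≤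
      θ (n - 1) - θ 0 := by
    rw [← Finset.sum_range_sub]
    refine Finset.sum_le_sum fun k hk => ?_
    have hk' := Finset.mem_range.1 hk
    exact arccos_le_of_cos_le (sub_nonneg.2 (hθmono k (k + 1) (by omega) (by omega)))
      (hcos k (by omega) (k + 1) (by omega) (by omega))
  have hlast : oneAngularDist (z (n - 1)) (z 0) ≤ θ 0 - θ (n - 1) + 2 * Real.pi := by
    refine arccos_le_of_cos_le (by linarith) ?_
    rw [Real.cos_add_two_pi]
    exact hcos (n - 1) (by omega) 0 (by omega) (by omega)
  linarith
end

section
/- Every 1-separated subset of D₁ = {(x,y,z) ∈ S_X : z > 1/2} has at most 1 element; likewise every 1-separated subset of D₁′ = {(x,y,z) ∈ S_X : z < −1/2} has at most 1 element. -/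
theorem sqrt_sub_sq_add_sub_sq_le (x y u v : ℝ) :
    √((x - u) ^ 2 + (y - v) ^ 2) ≤ √(x ^ 2 + y ^ 2) + √(u ^ 2 + v ^ 2) := by
  have hs : √(x ^ 2 + y ^ 2) ^ 2 = x ^ 2 + y ^ 2 := Real.sq_sqrt (by positivity)
  have ht : √(u ^ 2 + v ^ 2) ^ 2 = u ^ 2 + v ^ 2 := Real.sq_sqrt (by positivity)
  have hxu : -(x * u + y * v) ≤ √(x ^ 2 + y ^ 2) * √(u ^ 2 + v ^ 2) := by
    refine neg_le.mp (abs_le_of_sq_le_sq' ?_ (by positivity)).1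
    rw [mul_pow, hs, ht]
    nlinarith [sq_nonneg (x * v - y * u)]
  rw [Real.sqrt_le_left (by positivity)]
  nlinarith

theorem pettyDist_le (a b : ℝ × ℝ × ℝ) :
    pettyDist a b ≤ pettyNorm a - |a.2.2| + (pettyNorm b - |b.2.2|) + |a.2.2 - b.2.2| := by
  have h := sqrt_sub_sq_add_sub_sq_le a.1 a.2.1 b.1 b.2.1
  simp only [pettyDist, pettyNorm, Prod.fst_sub, Prod.snd_sub]
  linarith

theorem OneSeparated.encard_le_one {S : Set (ℝ × ℝ × ℝ)} (hsep : OneSeparated S)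
    (h : ∀ a ∈ S, ∀ b ∈ S, pettyDist a b < 1) : S.encard ≤ 1 := by
  rw [Set.encard_le_one_iff]
  intro a b ha hb
  by_contra hab
  exact (hsep a ha b hb hab).not_gt (h a ha b hb)

/-- a 1-separated subset of D₁ = {z > 1/2} (resp. D₁′ = {z < −1/2}) on the
Petty unit sphere has at most 1 element. -/
theorem oneSeparated_cap_top_zone (S : Set (ℝ × ℝ × ℝ)) (hsep : OneSeparated S) :
    (S ⊆ {a ∈ pettySphere | a.2.2 > 1/2} → S.encard ≤ 1) ∧
    (S ⊆ {a ∈ pettySphere | a.2.2 < -(1/2)} → S.encard ≤ 1) := by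
  refine ⟨fun hS => hsep.encard_le_one fun a ha b hb => ?_,
    fun hS => hsep.encard_le_one fun a ha b hb => ?_⟩
  all_goals
    obtain ⟨hna, hza⟩ := hS ha
    obtain ⟨hnb, hzb⟩ := hS hb
    simp only [pettySphere, Set.mem_ofPred_eq] at hna hnb
    refine (pettyDist_le a b).trans_lt ?_
    rw [hna, hnb]
    grind
end

section
/- Every 1-separated subset of D₂ = {(x,y,z) ∈ S_X : 1/3 < z ≤ 1/2} has at most 3 elements; likewise every 1-separated subset of D₂′ = {(x,y,z) ∈ S_X : −1/2 ≤ z < −1/3} has at most 3 elements. -/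
/-- Four vectors of the plane cannot have pairwise negative inner products. -/
theorem not_pairwise_inner_neg_four {a₁ a₂ b₁ b₂ c₁ c₂ d₁ d₂ : ℝ}
    (hab : a₁ * b₁ + a₂ * b₂ < 0) (hac : a₁ * c₁ + a₂ * c₂ < 0) (had : a₁ * d₁ + a₂ * d₂ < 0)
    (hbc : b₁ * c₁ + b₂ * c₂ < 0) (hbd : b₁ * d₁ + b₂ * d₂ < 0)
    (hcd : c₁ * d₁ + c₂ * d₂ < 0) : False := by
  have cross_neg {u₁ u₂ v₁ v₂ : ℝ} (huv : u₁ * v₁ + u₂ * v₂ < 0)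
      (hu : u₁ * d₁ + u₂ * d₂ < 0) (hv : v₁ * d₁ + v₂ * d₂ < 0) :
      (u₁ * d₂ - u₂ * d₁) * (v₁ * d₂ - v₂ * d₁) < 0 := by
    have h₁ := mul_pos_of_neg_of_neg hu hv
    have h₂ := mul_nonpos_of_nonpos_of_nonneg huv.le (add_nonneg (sq_nonneg d₁) (sq_nonneg d₂))
    linarith
  have h₁ := cross_neg hab had hbd
  have h₂ := cross_neg hac had hcd
  have h₃ := cross_neg hbc hbd hcd
  have h₄ := mul_neg_of_pos_of_neg (mul_pos_of_neg_of_neg h₁ h₂) h₃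
  have h₅ := sq_nonneg ((a₁ * d₂ - a₂ * d₁) * (b₁ * d₂ - b₂ * d₁) * (c₁ * d₂ - c₂ * d₁))
  linarith

/-- Points of the Petty sphere at heights between `1/3` and `1/2` on the same side of the plane
`z = 0` and at distance at least `1` have horizontal parts at an obtuse angle. -/
theorem inner_neg_of_one_le_pettyDist {a b : ℝ × ℝ × ℝ}
    (ha : a ∈ pettySphere) (hb : b ∈ pettySphere)
    (ha₁ : 1 / 3 < |a.2.2|) (ha₂ : |a.2.2| ≤ 1 / 2)
    (hb₁ : 1 / 3 < |b.2.2|) (hb₂ : |b.2.2| ≤ 1 / 2)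
    (hz : 0 ≤ a.2.2 * b.2.2) (hab : 1 ≤ pettyDist a b) :
    a.1 * b.1 + a.2.1 * b.2.1 < 0 := by
  obtain ⟨a₁, a₂, a₃⟩ := a
  obtain ⟨b₁, b₂, b₃⟩ := b
  simp only [pettySphere, pettyDist, pettyNorm, Set.mem_ofPred_eq, Prod.mk_sub_mk] at *
  have hr := Real.sq_sqrt (add_nonneg (sq_nonneg a₁) (sq_nonneg a₂))
  have hs := Real.sq_sqrt (add_nonneg (sq_nonneg b₁) (sq_nonneg b₂))
  have ht := Real.sq_sqrt (add_nonneg (sq_nonneg (a₁ - b₁)) (sq_nonneg (a₂ - b₂)))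
  have hd : |a₃ - b₃| = |(|a₃| - |b₃|)| := by
    rw [← sq_eq_sq₀ (abs_nonneg _) (abs_nonneg _), sq_abs, sq_abs, sub_sq, sub_sq, sq_abs, sq_abs,
      mul_assoc, mul_assoc, ← abs_mul, abs_of_nonneg hz]
  rw [hd] at hab
  generalize √(a₁ ^ 2 + a₂ ^ 2) = r at *
  generalize √(b₁ ^ 2 + b₂ ^ 2) = s at *
  generalize √((a₁ - b₁) ^ 2 + (a₂ - b₂) ^ 2) = t at *
  obtain rfl : r = 1 - |a₃| := by linarith
  obtain rfl : s = 1 - |b₃| := by linarith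
  generalize |a₃| = x at *
  generalize |b₃| = y at *
  rcases abs_cases (x - y) with ⟨h, _⟩ | ⟨h, _⟩
  · have := pow_le_pow_left₀ (show 0 ≤ 1 - |x - y| by linarith)
      (show 1 - |x - y| ≤ t by linarith) 2
    rw [h] at this
    nlinarith [mul_nonneg (show 0 ≤ 1 / 2 - x by linarith) (show 0 ≤ y by linarith)]
  · have := pow_le_pow_left₀ (show 0 ≤ 1 - |x - y| by linarith)
      (show 1 - |x - y| ≤ t by linarith) 2
    rw [h] at this
    nlinarith [mul_nonneg (show 0 ≤ 1 / 2 - y by linarith) (show 0 ≤ x by linarith)]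

theorem OneSeparated.encard_le_three {S : Set (ℝ × ℝ × ℝ)} (hsep : OneSeparated S)
    (hS : S ⊆ {a ∈ pettySphere | 1 / 3 < |a.2.2| ∧ |a.2.2| ≤ 1 / 2})
    (hz : ∀ a ∈ S, ∀ b ∈ S, 0 ≤ a.2.2 * b.2.2) : S.encard ≤ 3 := by
  have inner_neg {a b : ℝ × ℝ × ℝ} (ha : a ∈ S) (hb : b ∈ S) (hab : a ≠ b) :
      a.1 * b.1 + a.2.1 * b.2.1 < 0 :=
    inner_neg_of_one_le_pettyDist (hS ha).1 (hS hb).1 (hS ha).2.1 (hS ha).2.2 (hS hb).2.1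
      (hS hb).2.2 (hz a ha b hb) (hsep a ha b hb hab)
  by_contra! h
  obtain ⟨T, hTS, hT⟩ := Set.exists_subset_encard_eq (Order.add_one_le_of_lt h)
  obtain ⟨d, U, hdU, rfl, hU⟩ := Set.encard_eq_add_one_iff.1 hT
  obtain ⟨a, b, c, hab, hac, hbc, rfl⟩ := Set.encard_eq_three.1 hU
  simp only [Set.mem_insert_iff, Set.mem_singleton_iff, not_or] at hdU
  have hd : d ∈ S := hTS (by simp)
  have ha : a ∈ S := hTS (by simp)
  have hb : b ∈ S := hTS (by simp)
  have hc : c ∈ S := hTS (by simp)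
  exact not_pairwise_inner_neg_four (inner_neg ha hb hab) (inner_neg ha hc hac)
    (inner_neg ha hd (Ne.symm hdU.1)) (inner_neg hb hc hbc) (inner_neg hb hd (Ne.symm hdU.2.1))
    (inner_neg hc hd (Ne.symm hdU.2.2))

/-- a 1-separated subset of D₂ = {1/3 < z ≤ 1/2} (resp. D₂′) on the Petty
unit sphere has at most 3 elements. -/
theorem oneSeparated_cap_second_zone (S : Set (ℝ × ℝ × ℝ)) (hsep : OneSeparated S) :
    (S ⊆ {a ∈ pettySphere | 1/3 < a.2.2 ∧ a.2.2 ≤ 1/2} → S.encard ≤ 3) ∧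
    (S ⊆ {a ∈ pettySphere | -(1/2) ≤ a.2.2 ∧ a.2.2 < -(1/3)} → S.encard ≤ 3) := by
  refine ⟨fun hS => hsep.encard_le_three (hS.trans fun a ha => ?_) fun a ha b hb => ?_,
    fun hS => hsep.encard_le_three (hS.trans fun a ha => ?_) fun a ha b hb => ?_⟩
  · obtain ⟨h, h₁, h₂⟩ := ha
    have := abs_of_pos (show 0 < a.2.2 by linarith)
    exact ⟨h, by linarith, by linarith⟩
  · exact mul_nonneg (by linarith [(hS ha).2.1]) (by linarith [(hS hb).2.1])
  · obtain ⟨h, h₁, h₂⟩ := ha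
    have := abs_of_neg (show a.2.2 < 0 by linarith)
    exact ⟨h, by linarith, by linarith⟩
  · exact mul_nonneg_of_nonpos_of_nonpos (by linarith [(hS ha).2.2])
      (by linarith [(hS hb).2.2])
end

section
/- Every 1-separated subset of D₀ = {(x,y,z) ∈ S_X : −1/3 ≤ z ≤ 1/3} has at most 10 elements. -/
/-- The separation condition for two points of the unit sphere at heights `s` and `t` whose
horizontal projections enclose the angle `x`. -/
def AngularSep (s t x : ℝ) : Prop :=
  2 * (1 - |s|) * (1 - |t|) * Real.cos x ≤ (1 - |s|) ^ 2 + (1 - |t|) ^ 2 - (1 - |s - t|) ^ 2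

theorem AngularSep.symm {s t x : ℝ} (h : AngularSep s t x) : AngularSep t s x := by
  unfold AngularSep at *
  rw [abs_sub_comm t s]
  linarith

theorem AngularSep.neg {s t x : ℝ} (h : AngularSep s t x) : AngularSep (-s) (-t) x := by
  unfold AngularSep at *
  rw [abs_neg, abs_neg, show -s - -t = -(s - t) by ring, abs_neg]
  exact h

theorem AngularSep.of_same_sign {s t x : ℝ} (h : AngularSep s t x) (ht : 0 ≤ t) (hts : t ≤ s) :
    (1 - s) * (1 - t) * (2 * Real.cos x) ≤ 1 - 4 * t + 2 * s * t := by
  unfold AngularSep at h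
  rw [abs_of_nonneg ht, abs_of_nonneg (ht.trans hts), abs_of_nonneg (sub_nonneg.2 hts)] at h
  linarith

theorem AngularSep.of_opposite_sign {s t x : ℝ} (h : AngularSep s t x) (hs : 0 ≤ s) (ht : t ≤ 0) :
    (1 - s) * (1 + t) * (2 * Real.cos x) ≤ 1 + 2 * s * t := by
  unfold AngularSep at h
  rw [abs_of_nonpos ht, abs_of_nonneg hs, abs_of_nonneg (by linarith : 0 ≤ s - t)] at h
  linarith

theorem le_of_mul_two_mul_le {a c v n : ℝ} (ha : 0 < a) (h : a * (2 * v) ≤ n)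
    (hn : n ≤ a * (2 * c)) : v ≤ c := by
  have := le_of_mul_le_mul_left (h.trans hn) ha
  linarith

theorem AngularSep.cos_le_of_same_sign {s t x : ℝ} (h : AngularSep s t x)
    (ht : 0 ≤ t) (hts : t ≤ s) (hs : s ≤ 1 / 3) : Real.cos x ≤ 3 / 4 := by
  refine le_of_mul_two_mul_le (mul_pos (by linarith) (by linarith)) (h.of_same_sign ht hts) ?_
  nlinarith [mul_nonneg ht (sub_nonneg.2 hs)]

theorem AngularSep.cos_le_of_same_sign_of_far {s t x : ℝ} (h : AngularSep s t x)
    (ht : 1 / 6 ≤ t) (hts : t ≤ s) (hs : s ≤ 1 / 3) : Real.cos x ≤ 2 / 5 := by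
  refine le_of_mul_two_mul_le (mul_pos (by linarith) (by linarith))
    (h.of_same_sign (by linarith) hts) ?_
  nlinarith [mul_nonneg (sub_nonneg.2 ht) (sub_nonneg.2 hs)]

theorem AngularSep.cos_le_of_opposite_sign {s t x : ℝ} (h : AngularSep s t x)
    (hs : 0 ≤ s) (ht : t ≤ 0) (hs' : s ≤ 1 / 3) (ht' : -(1 / 3) ≤ t) : Real.cos x ≤ 7 / 8 := by
  refine le_of_mul_two_mul_le (mul_pos (by linarith) (by linarith)) (h.of_opposite_sign hs ht) ?_
  nlinarith [mul_nonneg (sub_nonneg.2 hs') (by linarith : 0 ≤ t + 1 / 3)]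

theorem AngularSep.cos_le_of_opposite_sign_of_near_left {s t x : ℝ} (h : AngularSep s t x)
    (hs : 0 ≤ s) (ht : t ≤ 0) (hs' : s ≤ 1 / 6) (ht' : -(1 / 3) ≤ t) : Real.cos x ≤ 4 / 5 := by
  refine le_of_mul_two_mul_le (mul_pos (by linarith) (by linarith)) (h.of_opposite_sign hs ht) ?_
  nlinarith [mul_nonneg (sub_nonneg.2 hs') (by linarith : 0 ≤ t + 1 / 3)]

theorem AngularSep.cos_le_of_opposite_sign_of_near_right {s t x : ℝ} (h : AngularSep s t x)
    (hs : 0 ≤ s) (ht : t ≤ 0) (hs' : s ≤ 1 / 3) (ht' : -(1 / 6) ≤ t) : Real.cos x ≤ 4 / 5 := by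
  refine le_of_mul_two_mul_le (mul_pos (by linarith) (by linarith)) (h.of_opposite_sign hs ht) ?_
  nlinarith [mul_nonneg (sub_nonneg.2 hs') (by linarith : 0 ≤ t + 1 / 6)]

/-- Either the two points lie far from the equator on opposite sides, or their angle is at least
`arccos (4 / 5)`. -/
theorem AngularSep.cos_le_or {s t x : ℝ} (h : AngularSep s t x) (hs : |s| ≤ 1 / 3)
    (ht : |t| ≤ 1 / 3) :
    Real.cos x ≤ 4 / 5 ∨ Real.cos x ≤ 7 / 8 ∧
      (1 / 6 ≤ s ∧ t ≤ -(1 / 6) ∨ s ≤ -(1 / 6) ∧ 1 / 6 ≤ t) := by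
  wlog hs0 : 0 ≤ s generalizing s t
  · have := this h.neg (by rwa [abs_neg]) (by rwa [abs_neg]) (by linarith)
    rcases this with h1 | ⟨h1, h2 | h2⟩
    · exact Or.inl h1
    · exact Or.inr ⟨h1, Or.inr ⟨by linarith, by linarith⟩⟩
    · exact Or.inr ⟨h1, Or.inl ⟨by linarith, by linarith⟩⟩
  rw [abs_le] at hs ht
  rcases le_total 0 t with ht0 | ht0
  · left
    rcases le_total t s with hts | hts
    · linarith [h.cos_le_of_same_sign ht0 hts hs.2]
    · linarith [h.symm.cos_le_of_same_sign hs0 hts ht.2]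
  · rcases le_total s (1 / 6) with h1 | h1
    · exact Or.inl (h.cos_le_of_opposite_sign_of_near_left hs0 ht0 h1 ht.1)
    rcases le_total (-(1 / 6)) t with h2 | h2
    · exact Or.inl (h.cos_le_of_opposite_sign_of_near_right hs0 ht0 hs.2 h2)
    · exact Or.inr ⟨h.cos_le_of_opposite_sign hs0 ht0 hs.2 ht.1, Or.inl ⟨h1, h2⟩⟩

theorem AngularSep.cos_le_of_far {s t x : ℝ} (h : AngularSep s t x)
    (hs : 1 / 6 ≤ s) (ht : 1 / 6 ≤ t) (hs' : s ≤ 1 / 3) (ht' : t ≤ 1 / 3) :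
    Real.cos x ≤ 2 / 5 := by
  rcases le_total t s with hts | hts
  · exact h.cos_le_of_same_sign_of_far ht hts hs'
  · exact h.symm.cos_le_of_same_sign_of_far hs hts ht'

theorem lt_cos_four_pi_div_eleven : 41 / 100 < Real.cos (4 * Real.pi / 11) := by
  have h1 : (9592 / 10000 : ℝ) ≤ Real.cos (Real.pi / 11) := by
    have h := Real.one_sub_sq_div_two_le_cos (x := Real.pi / 11)
    nlinarith [Real.pi_lt_d4, Real.pi_pos]
  have h2 : Real.cos (2 * (Real.pi / 11)) = 2 * Real.cos (Real.pi / 11) ^ 2 - 1 :=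
    Real.cos_two_mul _
  have h3 : Real.cos (4 * Real.pi / 11) = 2 * Real.cos (2 * (Real.pi / 11)) ^ 2 - 1 := by
    rw [← Real.cos_two_mul]
    congr 1
    ring
  have h4 : (8401 / 10000 : ℝ) ≤ Real.cos (2 * (Real.pi / 11)) := by nlinarith
  nlinarith

theorem lt_cos_of_le {x : ℝ} (hx : 0 ≤ x) (h : x ≤ 4 * Real.pi / 11) : 41 / 100 < Real.cos x :=
  lt_cos_four_pi_div_eleven.trans_le
    (Real.cos_le_cos_of_nonneg_of_le_pi hx (by linarith [Real.pi_pos]) h)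

theorem lt_add_of_cos_le {x y : ℝ} (hx : 0 ≤ x) (hy : 0 ≤ y) (hcx : Real.cos x ≤ 4 / 5)
    (hcy : Real.cos y ≤ 7 / 8) : 4 * Real.pi / 11 < x + y := by
  by_contra! hle
  have h := lt_cos_of_le (add_nonneg hx hy) hle
  have hx0 := lt_cos_of_le hx (by linarith)
  have hy0 := lt_cos_of_le hy (by linarith)
  have hsx := Real.sin_nonneg_of_nonneg_of_le_pi hx (by linarith [Real.pi_pos])
  have hsy := Real.sin_nonneg_of_nonneg_of_le_pi hy (by linarith [Real.pi_pos])
  have hx1 : 3 / 5 ≤ Real.sin x := by nlinarith [Real.sin_sq_add_cos_sq x]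
  have hy1 : 484 / 1000 ≤ Real.sin y := by nlinarith [Real.sin_sq_add_cos_sq y]
  rw [Real.cos_add] at h
  have h1 : Real.cos x * Real.cos y ≤ 4 / 5 * (7 / 8) :=
    mul_le_mul hcx hcy (by linarith) (by norm_num)
  have h2 : 3 / 5 * (484 / 1000) ≤ Real.sin x * Real.sin y :=
    mul_le_mul hx1 hy1 (by norm_num) hsx
  linarith

/-- Three consecutive points span an angle of more than `4π/11`. -/
theorem lt_add_of_angularSep {s t u x y : ℝ} (hs : |s| ≤ 1 / 3) (ht : |t| ≤ 1 / 3)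
    (hu : |u| ≤ 1 / 3) (hx : 0 ≤ x) (hy : 0 ≤ y) (hst : AngularSep s t x)
    (htu : AngularSep t u y) (hsu : AngularSep s u (x + y)) : 4 * Real.pi / 11 < x + y := by
  have key : Real.cos (x + y) ≤ 2 / 5 → 4 * Real.pi / 11 < x + y := by
    intro h
    by_contra! hle
    linarith [lt_cos_of_le (add_nonneg hx hy) hle]
  rcases hst.cos_le_or hs ht with h1 | ⟨h1, h1'⟩
  · exact lt_add_of_cos_le hx hy h1 (by rcases htu.cos_le_or ht hu with h | h <;> linarith [h])
  rcases htu.cos_le_or ht hu with h2 | ⟨-, h2'⟩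
  · rw [add_comm]
    exact lt_add_of_cos_le hy hx h2 h1
  apply key
  rw [abs_le] at hs hu
  rcases h1' with h1' | h1' <;> rcases h2' with h2' | h2'
  · linarith
  · exact hsu.cos_le_of_far h1'.1 h2'.2 hs.2 hu.2
  · exact hsu.neg.cos_le_of_far (by linarith) (by linarith) (by linarith) (by linarith)
  · linarith

/-- The polar angle of the horizontal projection. -/
noncomputable def horizontalArg (a : ℝ × ℝ × ℝ) : ℝ := Complex.arg ⟨a.1, a.2.1⟩

theorem polar_of_mem_pettySphere {a : ℝ × ℝ × ℝ} (ha : a ∈ pettySphere) :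
    a.1 = (1 - |a.2.2|) * Real.cos (horizontalArg a) ∧
      a.2.1 = (1 - |a.2.2|) * Real.sin (horizontalArg a) := by
  have hr : ‖(⟨a.1, a.2.1⟩ : ℂ)‖ = 1 - |a.2.2| := by
    rw [Complex.norm_eq_sqrt_sq_add_sq]
    exact eq_sub_of_add_eq ha
  rw [← hr]
  exact ⟨(Complex.norm_mul_cos_arg ⟨a.1, a.2.1⟩).symm, (Complex.norm_mul_sin_arg ⟨a.1, a.2.1⟩).symm⟩

theorem angularSep_of_one_le_pettyDist {a b : ℝ × ℝ × ℝ} (ha : a ∈ pettySphere)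
    (hb : b ∈ pettySphere) (ha' : |a.2.2| ≤ 1 / 3) (hb' : |b.2.2| ≤ 1 / 3)
    (hab : 1 ≤ pettyDist a b) :
    AngularSep a.2.2 b.2.2 (horizontalArg b - horizontalArg a) := by
  obtain ⟨ha1, ha2⟩ := polar_of_mem_pettySphere ha
  obtain ⟨hb1, hb2⟩ := polar_of_mem_pettySphere hb
  have hd : |a.2.2 - b.2.2| ≤ 1 := by linarith [abs_sub a.2.2 b.2.2]
  have h1 : 1 - |a.2.2 - b.2.2| ≤ Real.sqrt ((a.1 - b.1) ^ 2 + (a.2.1 - b.2.1) ^ 2) :=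
    sub_le_iff_le_add.2 hab
  rw [Real.le_sqrt (sub_nonneg.2 hd) (by positivity), ha1, ha2, hb1, hb2] at h1
  unfold AngularSep
  rw [Real.cos_sub]
  linear_combination h1 + (1 - |a.2.2|) ^ 2 * Real.sin_sq_add_cos_sq (horizontalArg a) +
    (1 - |b.2.2|) ^ 2 * Real.sin_sq_add_cos_sq (horizontalArg b)

theorem AngularSep.add_two_pi {s t x : ℝ} (h : AngularSep s t x) :
    AngularSep s t (x + 2 * Real.pi) := by
  unfold AngularSep at *
  rwa [Real.cos_add_two_pi]

/-- No eleven points in the zone are pairwise separated, in terms of heights and angles. -/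
theorem not_eleven_angularSep (z θ : Fin 11 → ℝ) (hz : ∀ i, |z i| ≤ 1 / 3) (hmono : Monotone θ)
    (hθ : ∀ i j, θ j ≤ θ i + 2 * Real.pi)
    (hsep : ∀ i j, i ≠ j → AngularSep (z i) (z j) (θ j - θ i)) : False := by
  have inner (i j k : Fin 11) (hij : i < j) (hjk : j < k) :
      4 * Real.pi / 11 < θ k - θ i := by
    have := lt_add_of_angularSep (hz i) (hz j) (hz k) (sub_nonneg.2 (hmono hij.le))
      (sub_nonneg.2 (hmono hjk.le)) (hsep i j hij.ne) (hsep j k hjk.ne)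
      (by simpa using hsep i k (hij.trans hjk).ne)
    linarith
  have wrap_last (i j k : Fin 11) (hij : i < j) (hki : k < i) :
      4 * Real.pi / 11 < θ k + 2 * Real.pi - θ i := by
    have h1 := (hsep j k (hki.trans hij).ne').add_two_pi
    have h2 := (hsep i k hki.ne').add_two_pi
    have := lt_add_of_angularSep (hz i) (hz j) (hz k) (sub_nonneg.2 (hmono hij.le))
      (by linarith [hθ k j]) (hsep i j hij.ne) h1 (by convert h2 using 1; ring)
    linarith
  have wrap_first (i j k : Fin 11) (hjk : j < k) (hki : k < i) :
      4 * Real.pi / 11 < θ k + 2 * Real.pi - θ i := by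
    have h1 := (hsep i j (hjk.trans hki).ne').add_two_pi
    have h2 := (hsep i k hki.ne').add_two_pi
    have := lt_add_of_angularSep (hz i) (hz j) (hz k) (by linarith [hθ j i])
      (sub_nonneg.2 (hmono hjk.le)) h1 (hsep j k hjk.ne) (by convert h2 using 1; ring)
    linarith
  linarith [inner 0 1 2 (by decide) (by decide), inner 2 3 4 (by decide) (by decide),
    inner 4 5 6 (by decide) (by decide), inner 6 7 8 (by decide) (by decide),
    inner 8 9 10 (by decide) (by decide), wrap_first 10 0 1 (by decide) (by decide),
    inner 1 2 3 (by decide) (by decide), inner 3 4 5 (by decide) (by decide),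
    inner 5 6 7 (by decide) (by decide), inner 7 8 9 (by decide) (by decide),
    wrap_last 9 10 0 (by decide) (by decide)]

/-- a 1-separated subset of D₀ = {−1/3 ≤ z ≤ 1/3} on the Petty unit sphere
has at most 10 elements. -/
theorem oneSeparated_cap_middle_zone (S : Set (ℝ × ℝ × ℝ)) (hsep : OneSeparated S)
    (hS : S ⊆ {a ∈ pettySphere | -(1/3) ≤ a.2.2 ∧ a.2.2 ≤ 1/3}) :
    S.encard ≤ 10 := by
  by_contra! hcard
  have h11 : ((11 : ℕ) : ℕ∞) ≤ S.encard := by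
    have := Order.add_one_le_of_lt hcard
    norm_num at this ⊢
    exact this
  obtain ⟨T, hTS, hT⟩ := Set.exists_subset_encard_eq h11
  have hfin : T.Finite := Set.finite_of_encard_eq_coe hT
  have hTc : hfin.toFinset.card = 11 := by
    rw [hfin.encard_eq_coe_toFinset_card] at hT
    exact_mod_cast hT
  let e := hfin.toFinset.equivFinOfCardEq hTc
  let f : Fin 11 → ℝ × ℝ × ℝ := fun i => e.symm i
  have hf (i : Fin 11) : f i ∈ S := hTS (hfin.mem_toFinset.1 (e.symm i).2)
  have hinj : Function.Injective f := Subtype.val_injective.comp e.symm.injective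
  let σ := Tuple.sort (horizontalArg ∘ f)
  have hz (i : Fin 11) : |(f (σ i)).2.2| ≤ 1 / 3 := abs_le.2 (hS (hf (σ i))).2
  refine not_eleven_angularSep (fun i => (f (σ i)).2.2) (horizontalArg ∘ f ∘ σ) hz
    (Tuple.monotone_sort (horizontalArg ∘ f)) (fun i j => ?_) (fun i j hij => ?_)
  · have h1 := Complex.arg_le_pi ⟨(f (σ j)).1, (f (σ j)).2.1⟩
    have h2 := Complex.neg_pi_lt_arg ⟨(f (σ i)).1, (f (σ i)).2.1⟩
    simp only [Function.comp_apply, horizontalArg]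
    linarith
  · exact angularSep_of_one_le_pettyDist (hS (hf _)).1 (hS (hf _)).1 (hz i) (hz j)
      (hsep _ (hf _) _ (hf _) (hinj.ne (σ.injective.ne hij)))
end

section
/- Every 1-separated subset of the unit sphere S_X of the Petty space has at most 18 elements. -/
open Real in
/-- Four angle doublings applied to `1 - t ^ 2 / 2 ≤ cos t` at `t = x / 16`. -/
lemma le_cos_of_iterated_doubling {x u l₁ l₂ l₃ l₄ : ℝ} (hx : 0 ≤ x) (hxu : x ≤ u)
    (h₁ : l₁ ≤ 2 * (1 - (u / 16) ^ 2 / 2) ^ 2 - 1) (h₂ : l₂ ≤ 2 * l₁ ^ 2 - 1)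
    (h₃ : l₃ ≤ 2 * l₂ ^ 2 - 1) (h₄ : l₄ ≤ 2 * l₃ ^ 2 - 1)
    (hu : 0 ≤ 1 - (u / 16) ^ 2 / 2) (hl₁ : 0 ≤ l₁) (hl₂ : 0 ≤ l₂) (hl₃ : 0 ≤ l₃) :
    l₄ ≤ cos x := by
  have double : ∀ l t : ℝ, 0 ≤ l → l ≤ cos t → 2 * l ^ 2 - 1 ≤ cos (2 * t) := by
    intro l t hl h
    rw [cos_two_mul]
    nlinarith
  have h0 : 1 - (u / 16) ^ 2 / 2 ≤ cos (x / 16) := by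
    have := one_sub_sq_div_two_le_cos (x := x / 16)
    nlinarith
  have c₁ := double _ _ hu h0
  have c₂ := double _ _ hl₁ (h₁.trans c₁)
  have c₃ := double _ _ hl₂ (h₂.trans c₂)
  have c₄ := double _ _ hl₃ (h₃.trans c₃)
  rw [show 2 * (2 * (2 * (2 * (x / 16)))) = x by ring] at c₄
  exact h₄.trans c₄

open Real in
lemma cos_seven_pi_div_eighteen_ge : 0.341 ≤ cos (7 * π / 18) := by
  have := pi_lt_d4
  refine le_cos_of_iterated_doubling (u := 1.22174) (l₁ := 0.98835) (l₂ := 0.95367)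
    (l₃ := 0.81897) (by positivity) (by linarith) ?_ ?_ ?_ ?_ ?_ ?_ ?_ ?_ <;> norm_num

open Real in
lemma cos_four_pi_div_nine_gt : 0.16 < cos (4 * π / 9) := by
  have := pi_lt_d4
  refine lt_of_lt_of_le (show (0.16 : ℝ) < 0.165 by norm_num)
    (le_cos_of_iterated_doubling (u := 1.39627) (l₁ := 0.9847) (l₂ := 0.9392)
    (l₃ := 0.764) (by positivity) (by linarith) ?_ ?_ ?_ ?_ ?_ ?_ ?_ ?_) <;> norm_num

open Real in
lemma cos_thirteen_pi_div_sixty_ge : 0.776 ≤ cos (13 * π / 60) := by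
  have := pi_lt_d4
  refine le_cos_of_iterated_doubling (u := 0.68068) (l₁ := 0.99638) (l₂ := 0.98554)
    (l₃ := 0.94257) (by positivity) (by linarith) ?_ ?_ ?_ ?_ ?_ ?_ ?_ ?_ <;> norm_num

open Real in
lemma cos_four_pi_div_fifteen_gt : 0.667 < cos (4 * π / 15) := by
  have := pi_lt_d4
  refine lt_of_lt_of_le (show (0.667 : ℝ) < 0.6675 by norm_num)
    (le_cos_of_iterated_doubling (u := 0.83776) (l₁ := 0.99452) (l₂ := 0.97813)
    (l₃ := 0.9134) (by positivity) (by linarith) ?_ ?_ ?_ ?_ ?_ ?_ ?_ ?_) <;> norm_num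

open Real in
lemma le_and_le_of_cos_le_cos {g a : ℝ} (hg : 0 < g) (hg' : g < 2 * π)
    (haπ : a ≤ π) (h : cos g ≤ cos a) : a ≤ g ∧ g ≤ 2 * π - a := by
  constructor
  · by_contra! hlt
    exact absurd (cos_lt_cos_of_nonneg_of_le_pi hg.le haπ hlt) h.not_gt
  · by_contra! hlt
    have := cos_lt_cos_of_nonneg_of_le_pi (x := 2 * π - g) (by linarith) haπ (by linarith)
    rw [cos_two_pi_sub] at this
    exact absurd this h.not_gt

open Real in
lemma lt_and_lt_of_cos_lt_cos {g b : ℝ} (hg : 0 < g) (hg' : g < 2 * π)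
    (hbπ : b ≤ π) (h : cos g < cos b) : b < g ∧ g < 2 * π - b := by
  obtain ⟨h₁, h₂⟩ := le_and_le_of_cos_le_cos hg hg' hbπ h.le
  refine ⟨lt_of_le_of_ne h₁ ?_, lt_of_le_of_ne h₂ ?_⟩
  · rintro rfl
    exact lt_irrefl _ h
  · rintro rfl
    rw [cos_two_pi_sub] at h
    exact lt_irrefl _ h

open Real in
/-- An odd cycle of two-coloured directions has two cyclically consecutive directions of the same
colour, so the angular gaps cannot all be as small as for directions of different colours. -/
lemma no_odd_cycle_of_directions {m : ℕ} (hm : 0 < m) (hme : Even m) {a b : ℝ}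
    (hab : a ≤ b) (hbπ : b ≤ π) (htot : 2 * π ≤ m * a + b) {t : ℕ → ℝ} {c : ℕ → Prop}
    (hmono : ∀ i j, i < j → j ≤ m → t i < t j ∧ t j < t i + 2 * π)
    (hdiff : ∀ i j, i < j → j ≤ m → cos (t j - t i) ≤ cos a)
    (hsame : ∀ i j, i < j → j ≤ m → (c i ↔ c j) → cos (t j - t i) < cos b) : False := by
  have gap : ∀ i j, i < j → j ≤ m → a ≤ t j - t i ∧ t j - t i ≤ 2 * π - a := by
    intro i j hij hj
    have := hmono i j hij hj
    exact le_and_le_of_cos_le_cos (by linarith) (by linarith) (hab.trans hbπ) (hdiff i j hij hj)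
  have gap_same : ∀ i j, i < j → j ≤ m → (c i ↔ c j) →
      b < t j - t i ∧ t j - t i < 2 * π - b := by
    intro i j hij hj hc
    have := hmono i j hij hj
    exact lt_and_lt_of_cos_lt_cos (by linarith) (by linarith) hbπ
      (hsame i j hij hj hc)
  have key : ∀ k, k ≤ m → (k * a ≤ t k - t 0 ∧ ((c 0 ↔ c k) ↔ Even k)) ∨
      k * a + b < t k - t 0 + a := by
    intro k
    induction k with
    | zero => intro _; left; simp
    | succ k ih =>
      intro hk
      have h₁ := gap k (k + 1) (by omega) hk
      push_cast
      rcases ih (by omega) with ⟨h, hc⟩ | h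
      · by_cases hkc : c k ↔ c (k + 1)
        · right
          have h₂ := gap_same k (k + 1) (by omega) hk hkc
          linarith
        · left
          refine ⟨by linarith, ?_⟩
          rw [Nat.even_add_one, ← hc]
          tauto
      · right
        linarith
  rcases key m le_rfl with ⟨h, hc⟩ | h
  · have := gap_same 0 m hm le_rfl (hc.2 hme)
    linarith
  · have := gap 0 m hm le_rfl
    linarith

open Real in
lemma encard_le_of_two_coloured_angles {ι : Type*} {m : ℕ} (hm : 0 < m) (hme : Even m) {a b : ℝ}
    (ha : 0 < a) (hab : a ≤ b) (hbπ : b ≤ π) (htot : 2 * π ≤ m * a + b) {s : Set ι} {θ : ι → ℝ}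
    {c : ι → Prop} (hθ : ∀ p ∈ s, θ p ∈ Set.Ioc (-π) π)
    (hdiff : ∀ p ∈ s, ∀ q ∈ s, p ≠ q → cos (θ p - θ q) ≤ cos a)
    (hsame : ∀ p ∈ s, ∀ q ∈ s, p ≠ q → (c p ↔ c q) → cos (θ p - θ q) < cos b) :
    s.encard ≤ m := by
  classical
  by_contra! hlt
  obtain ⟨T, hTs, hT⟩ := Set.exists_subset_encard_eq (s := s) (k := ((m + 1 : ℕ) : ℕ∞))
    (by push_cast; exact Order.add_one_le_of_lt hlt)
  have hfin : T.Finite := Set.finite_of_encard_eq_coe hT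
  have hcos : cos a < 1 := by
    have := cos_lt_cos_of_nonneg_of_le_pi (x := 0) le_rfl (hab.trans hbπ) ha
    rwa [cos_zero] at this
  have hinj : Set.InjOn θ T := by
    intro p hp q hq hpq
    by_contra hne
    have := hdiff p (hTs hp) q (hTs hq) hne
    rw [hpq, sub_self, cos_zero] at this
    linarith
  set A : Finset ℝ := hfin.toFinset.image θ with hA
  have hcard : A.card = m + 1 := by
    rw [hA, Finset.card_image_of_injOn (by simpa using hinj)]
    rw [hfin.encard_eq_coe_toFinset_card] at hT
    exact_mod_cast hT
  have hex : ∀ i : Fin (m + 1), ∃ p ∈ T, θ p = A.orderEmbOfFin hcard i := by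
    intro i
    have := A.orderEmbOfFin_mem hcard i
    simpa only [hA, Finset.mem_image, Set.Finite.mem_toFinset] using this
  choose p hpT hp using hex
  have hlt : ∀ i j : Fin (m + 1), i < j → θ (p i) < θ (p j) := by
    intro i j hij
    rw [hp, hp]
    exact (A.orderEmbOfFin hcard).strictMono hij
  have hof : ∀ i j, i < j → j ≤ m → Fin.ofNat (m + 1) i < Fin.ofNat (m + 1) j := by
    intro i j hij hj
    simp only [Fin.lt_def, Fin.ofNat]
    rw [Nat.mod_eq_of_lt (by omega), Nat.mod_eq_of_lt (by omega)]
    exact hij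
  have hne : ∀ i j, i < j → j ≤ m → p (Fin.ofNat (m + 1) j) ≠ p (Fin.ofNat (m + 1) i) := by
    intro i j hij hj h
    have := hlt _ _ (hof i j hij hj)
    rw [h] at this
    exact lt_irrefl _ this
  refine no_odd_cycle_of_directions hm hme hab hbπ htot
    (t := fun k => θ (p (Fin.ofNat (m + 1) k))) (c := fun k => c (p (Fin.ofNat (m + 1) k))) ?_ ?_ ?_
  · intro i j hij hj
    refine ⟨hlt _ _ (hof i j hij hj), ?_⟩
    have h₁ := (hθ _ (hTs (hpT (Fin.ofNat (m + 1) i)))).1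
    have h₂ := (hθ _ (hTs (hpT (Fin.ofNat (m + 1) j)))).2
    linarith
  · intro i j hij hj
    exact hdiff _ (hTs (hpT _)) _ (hTs (hpT _)) (hne i j hij hj)
  · intro i j hij hj hc
    exact hsame _ (hTs (hpT _)) _ (hTs (hpT _)) (hne i j hij hj) hc.symm

/-- The Euclidean norm of the horizontal part of a point. -/
noncomputable def horizontalRadius (p : ℝ × ℝ × ℝ) : ℝ := √(p.1 ^ 2 + p.2.1 ^ 2)

/-- The polar angle of the horizontal part of a point. -/
noncomputable def horizontalAngle (p : ℝ × ℝ × ℝ) : ℝ := Complex.arg ⟨p.1, p.2.1⟩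

lemma horizontalRadius_nonneg (p : ℝ × ℝ × ℝ) : 0 ≤ horizontalRadius p := Real.sqrt_nonneg _

lemma horizontalRadius_add_abs {p : ℝ × ℝ × ℝ} (hp : p ∈ pettySphere) :
    horizontalRadius p + |p.2.2| = 1 := hp

lemma horizontalRadius_le_one {p : ℝ × ℝ × ℝ} (hp : p ∈ pettySphere) :
    horizontalRadius p ≤ 1 := by
  linarith [horizontalRadius_add_abs hp, abs_nonneg p.2.2]

lemma pettyDist_eq (p q : ℝ × ℝ × ℝ) :
    pettyDist p q = √(horizontalRadius p ^ 2 + horizontalRadius q ^ 2 - 2 * horizontalRadius p *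
      horizontalRadius q * Real.cos (horizontalAngle p - horizontalAngle q)) +
      |p.2.2 - q.2.2| := by
  have polar : ∀ p : ℝ × ℝ × ℝ, p.1 = horizontalRadius p * Real.cos (horizontalAngle p) ∧
      p.2.1 = horizontalRadius p * Real.sin (horizontalAngle p) := by
    intro p
    have h : ‖(⟨p.1, p.2.1⟩ : ℂ)‖ = horizontalRadius p := by
      rw [horizontalRadius, Complex.norm_def, Complex.normSq_mk]
      ring_nf
    have h₁ := Complex.norm_mul_cos_arg ⟨p.1, p.2.1⟩
    have h₂ := Complex.norm_mul_sin_arg ⟨p.1, p.2.1⟩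
    rw [h] at h₁ h₂
    exact ⟨h₁.symm, h₂.symm⟩
  obtain ⟨hp₁, hp₂⟩ := polar p
  obtain ⟨hq₁, hq₂⟩ := polar q
  have hsq : (p.1 - q.1) ^ 2 + (p.2.1 - q.2.1) ^ 2 = horizontalRadius p ^ 2 +
      horizontalRadius q ^ 2 - 2 * horizontalRadius p * horizontalRadius q *
      Real.cos (horizontalAngle p - horizontalAngle q) := by
    rw [hp₁, hp₂, hq₁, hq₂, Real.cos_sub]
    linear_combination horizontalRadius p ^ 2 * Real.sin_sq_add_cos_sq (horizontalAngle p) +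
      horizontalRadius q ^ 2 * Real.sin_sq_add_cos_sq (horizontalAngle q)
  rw [← hsq]
  rfl

lemma same_side_bound {p q : ℝ × ℝ × ℝ} (hp : p ∈ pettySphere) (hq : q ∈ pettySphere)
    (hpq : 0 ≤ p.2.2 ↔ 0 ≤ q.2.2) (hd : 1 ≤ pettyDist p q) :
    1 - 2 * |horizontalRadius p - horizontalRadius q| ≤ 2 * (horizontalRadius p *
      horizontalRadius q) * (1 - Real.cos (horizontalAngle p - horizontalAngle q)) := by
  have hp₁ := horizontalRadius_add_abs hp
  have hq₁ := horizontalRadius_add_abs hq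
  have hz : |p.2.2 - q.2.2| = |horizontalRadius p - horizontalRadius q| := by
    rcases le_or_gt 0 p.2.2 with h | h
    · rw [abs_of_nonneg h] at hp₁
      rw [abs_of_nonneg (hpq.1 h)] at hq₁
      rw [abs_sub_comm]
      congr 1
      linarith
    · have h' : q.2.2 < 0 := by
        by_contra! hc
        exact absurd (hpq.2 hc) h.not_ge
      rw [abs_of_neg h] at hp₁
      rw [abs_of_neg h'] at hq₁
      congr 1
      linarith
  have hle : |horizontalRadius p - horizontalRadius q| ≤ 1 := by
    rw [abs_le]
    constructor <;> linarith [horizontalRadius_nonneg p, horizontalRadius_nonneg q,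
      horizontalRadius_le_one hp, horizontalRadius_le_one hq]
  rw [pettyDist_eq, hz] at hd
  have := Real.le_sqrt' (x := 1 - |horizontalRadius p - horizontalRadius q|)
    (y := horizontalRadius p ^ 2 + horizontalRadius q ^ 2 - 2 * horizontalRadius p *
      horizontalRadius q * Real.cos (horizontalAngle p - horizontalAngle q))
  rcases hle.lt_or_eq with h | h
  · have h₂ := (this (by linarith)).1 (by linarith)
    nlinarith [sq_abs (horizontalRadius p - horizontalRadius q)]
  · rw [h]
    nlinarith [mul_nonneg (mul_nonneg (horizontalRadius_nonneg p) (horizontalRadius_nonneg q))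
      (sub_nonneg.2 (Real.cos_le_one (horizontalAngle p - horizontalAngle q)))]

lemma opposite_side_bound {p q : ℝ × ℝ × ℝ} (hp : p ∈ pettySphere) (hq : q ∈ pettySphere)
    (hpq : ¬(0 ≤ p.2.2 ↔ 0 ≤ q.2.2)) (hr : 1 < horizontalRadius p + horizontalRadius q)
    (hd : 1 ≤ pettyDist p q) :
    2 * (horizontalRadius p * horizontalRadius q) *
      (1 + Real.cos (horizontalAngle p - horizontalAngle q)) ≤
      2 * (horizontalRadius p + horizontalRadius q) - 1 := by
  have hp₁ := horizontalRadius_add_abs hp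
  have hq₁ := horizontalRadius_add_abs hq
  have hz : |p.2.2 - q.2.2| = 2 - horizontalRadius p - horizontalRadius q := by
    rcases le_or_gt 0 p.2.2 with h | h
    · have h' : q.2.2 < 0 := by
        by_contra! hc
        exact hpq ⟨fun _ => hc, fun _ => h⟩
      rw [abs_of_nonneg (by linarith)]
      rw [abs_of_nonneg h] at hp₁
      rw [abs_of_neg h'] at hq₁
      linarith
    · have h' : 0 ≤ q.2.2 := by
        by_contra hc
        exact hpq ⟨fun h'' => absurd h'' h.not_ge, fun h'' => absurd h'' hc⟩
      rw [abs_of_nonpos (by linarith)]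
      rw [abs_of_neg h] at hp₁
      rw [abs_of_nonneg h'] at hq₁
      linarith
  rw [pettyDist_eq, hz] at hd
  have := (Real.le_sqrt' (x := horizontalRadius p + horizontalRadius q - 1) (by linarith)).1
    (show _ ≤ √(horizontalRadius p ^ 2 + horizontalRadius q ^ 2 - 2 * horizontalRadius p *
      horizontalRadius q * Real.cos (horizontalAngle p - horizontalAngle q)) by linarith)
  linarith

/-- An upper bound on `c` from the bound that two points on the same side satisfy, for radii in
`[l, u]`. -/
lemma lt_of_same_side_bound {r q c l u d : ℝ} (hl : 1 / 2 ≤ l) (hu : u ≤ 1) (hr : r ∈ Set.Icc l u)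
    (hq : q ∈ Set.Icc l u) (hd : 0 ≤ d) (hd₁ : d ≤ 1)
    (hlu : 2 * (l * u) * (1 - d) < 1 - 2 * (u - l))
    (h : 1 - 2 * |r - q| ≤ 2 * (r * q) * (1 - c)) : c < d := by
  wlog hqr : q ≤ r generalizing r q
  · exact this hq hr (by rwa [abs_sub_comm, mul_comm q]) (le_of_not_ge hqr)
  rw [abs_of_nonneg (sub_nonneg.2 hqr)] at h
  obtain ⟨hlr, hru⟩ := hr
  obtain ⟨hlq, -⟩ := hq
  by_contra! hc
  have hrq : 0 ≤ r * q := mul_nonneg (by linarith) (by linarith)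
  have h₁ : r * q * (1 - c) ≤ r * q * (1 - d) := by gcongr
  have h₂ : 0 ≤ (q - l) * (1 - r * (1 - d)) := by
    apply mul_nonneg (by linarith)
    nlinarith
  have h₃ : 0 ≤ (u - r) * (1 + l * (1 - d)) :=
    mul_nonneg (by linarith) (by nlinarith)
  nlinarith

/-- At most one point on each side of the equator has horizontal radius below `1 / 2`. -/
lemma encard_cap_le {S : Set (ℝ × ℝ × ℝ)} (hsep : OneSeparated S) (hS : S ⊆ pettySphere)
    (σ : Prop) : {p ∈ S | (0 ≤ p.2.2 ↔ σ) ∧ horizontalRadius p < 1 / 2}.encard ≤ 1 := by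
  rw [Set.encard_le_one_iff]
  rintro p q ⟨hpS, hpσ, hp⟩ ⟨hqS, hqσ, hq⟩
  by_contra hne
  have h := same_side_bound (hS hpS) (hS hqS) (hpσ.trans hqσ.symm) (hsep p hpS q hqS hne)
  have hc := Real.neg_one_le_cos (horizontalAngle p - horizontalAngle q)
  have hp₀ := horizontalRadius_nonneg p
  have hq₀ := horizontalRadius_nonneg q
  have hpq := mul_nonneg hp₀ hq₀
  rcases abs_cases (horizontalRadius p - horizontalRadius q) with ⟨h', -⟩ | ⟨h', -⟩ <;>
    rw [h'] at h <;> nlinarith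

lemma horizontalAngle_mem (p : ℝ × ℝ × ℝ) :
    horizontalAngle p ∈ Set.Ioc (-Real.pi) Real.pi := Complex.arg_mem_Ioc _

lemma encard_band_le {S : Set (ℝ × ℝ × ℝ)} (hsep : OneSeparated S) (hS : S ⊆ pettySphere)
    (σ : Prop) : {p ∈ S | (0 ≤ p.2.2 ↔ σ) ∧ 1 / 2 ≤ horizontalRadius p ∧
      horizontalRadius p < 0.752}.encard ≤ 4 := by
  have hπ := Real.pi_pos
  refine encard_le_of_two_coloured_angles (m := 4) (a := 7 * Real.pi / 18) (b := 4 * Real.pi / 9)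
    (θ := horizontalAngle) (c := fun p => horizontalRadius p < 0.7) (by norm_num) (by decide)
    (by positivity) (by linarith) (by linarith) (by push_cast; linarith)
    (fun p _ => horizontalAngle_mem p) ?_ ?_
  · rintro p ⟨hpS, hpσ, hp⟩ q ⟨hqS, hqσ, hq⟩ hne
    have h := same_side_bound (hS hpS) (hS hqS) (hpσ.trans hqσ.symm) (hsep p hpS q hqS hne)
    exact (lt_of_same_side_bound (l := 1 / 2) (u := 0.752) (d := 0.341) le_rfl (by norm_num)
      ⟨hp.1, hp.2.le⟩ ⟨hq.1, hq.2.le⟩ (by norm_num) (by norm_num) (by norm_num) h).le.trans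
      cos_seven_pi_div_eighteen_ge
  · rintro p ⟨hpS, hpσ, hp⟩ q ⟨hqS, hqσ, hq⟩ hne hc
    have h := same_side_bound (hS hpS) (hS hqS) (hpσ.trans hqσ.symm) (hsep p hpS q hqS hne)
    refine lt_trans ?_ cos_four_pi_div_nine_gt
    by_cases hp' : horizontalRadius p < 0.7
    · exact lt_of_same_side_bound (l := 1 / 2) (u := 0.7) le_rfl (by norm_num)
        ⟨hp.1, hp'.le⟩ ⟨hq.1, (hc.1 hp').le⟩ (by norm_num) (by norm_num) (by norm_num) h
    · have hq' : ¬horizontalRadius q < 0.7 := fun h' => hp' (hc.2 h')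
      exact lt_of_same_side_bound (l := 0.7) (u := 0.752) (by norm_num) (by norm_num)
        ⟨not_lt.1 hp', hp.2.le⟩ ⟨not_lt.1 hq', hq.2.le⟩ (by norm_num) (by norm_num) (by norm_num) h

lemma encard_belt_le {S : Set (ℝ × ℝ × ℝ)} (hsep : OneSeparated S) (hS : S ⊆ pettySphere) :
    {p ∈ S | 0.752 ≤ horizontalRadius p}.encard ≤ 8 := by
  have hπ := Real.pi_pos
  have same : ∀ p ∈ S, ∀ q ∈ S, p ≠ q → 0.752 ≤ horizontalRadius p → 0.752 ≤ horizontalRadius q →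
      (0 ≤ p.2.2 ↔ 0 ≤ q.2.2) → Real.cos (horizontalAngle p - horizontalAngle q) < 0.667 := by
    intro p hpS q hqS hne hp hq hc
    exact lt_of_same_side_bound (l := 0.752) (u := 1) (by norm_num) le_rfl
      ⟨hp, horizontalRadius_le_one (hS hpS)⟩ ⟨hq, horizontalRadius_le_one (hS hqS)⟩ (by norm_num)
      (by norm_num) (by norm_num) (same_side_bound (hS hpS) (hS hqS) hc (hsep p hpS q hqS hne))
  refine encard_le_of_two_coloured_angles (m := 8) (a := 13 * Real.pi / 60)
    (b := 4 * Real.pi / 15) (θ := horizontalAngle) (c := fun p => 0 ≤ p.2.2) (by norm_num)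
    (by decide) (by positivity) (by linarith) (by linarith) (by push_cast; linarith)
    (fun p _ => horizontalAngle_mem p) ?_ ?_
  · rintro p ⟨hpS, hp⟩ q ⟨hqS, hq⟩ hne
    refine le_trans ?_ cos_thirteen_pi_div_sixty_ge
    by_cases hc : 0 ≤ p.2.2 ↔ 0 ≤ q.2.2
    · linarith [same p hpS q hqS hne hp hq hc]
    · have h := opposite_side_bound (hS hpS) (hS hqS) hc (by linarith) (hsep p hpS q hqS hne)
      by_contra! hlt
      have hpq : 0 < horizontalRadius p * horizontalRadius q :=
        mul_pos (by linarith) (by linarith)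
      have h₁ := mul_lt_mul_of_pos_left hlt hpq
      nlinarith [mul_nonneg (sub_nonneg.2 hp) (sub_nonneg.2 hq)]
  · rintro p ⟨hpS, hp⟩ q ⟨hqS, hq⟩ hne hc
    exact (same p hpS q hqS hne hp hq hc).trans cos_four_pi_div_fifteen_gt

/-- every 1-separated subset of the Petty unit sphere has at most 18 elements. -/
theorem oneSeparated_sphere_le_18 (S : Set (ℝ × ℝ × ℝ)) (hsep : OneSeparated S)
    (hS : S ⊆ pettySphere) : S.encard ≤ 18 := by
  have hcover : S ⊆ ({p ∈ S | (0 ≤ p.2.2 ↔ True) ∧ horizontalRadius p < 1 / 2} ∪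
      {p ∈ S | (0 ≤ p.2.2 ↔ False) ∧ horizontalRadius p < 1 / 2}) ∪
      ({p ∈ S | (0 ≤ p.2.2 ↔ True) ∧ 1 / 2 ≤ horizontalRadius p ∧ horizontalRadius p < 0.752} ∪
      {p ∈ S | (0 ≤ p.2.2 ↔ False) ∧ 1 / 2 ≤ horizontalRadius p ∧ horizontalRadius p < 0.752}) ∪
      {p ∈ S | 0.752 ≤ horizontalRadius p} := by
    intro p hp
    simp only [Set.mem_union, Set.mem_ofPred_eq, hp, true_and, ← not_lt (b := (1 / 2 : ℝ)),
      ← not_lt (b := (0.752 : ℝ))]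
    tauto
  calc S.encard ≤ _ := Set.encard_le_encard hcover
    _ ≤ (1 + 1) + (4 + 4) + 8 := by
      refine (Set.encard_union_le _ _).trans (add_le_add ((Set.encard_union_le _ _).trans
        (add_le_add ((Set.encard_union_le _ _).trans (add_le_add ?_ ?_))
        ((Set.encard_union_le _ _).trans (add_le_add ?_ ?_)))) ?_)
      · exact encard_cap_le hsep hS True
      · exact encard_cap_le hsep hS False
      · exact encard_band_le hsep hS True
      · exact encard_band_le hsep hS False
      · exact encard_belt_le hsep hS
    _ = 18 := by norm_num
end

section
/- Let S be a 1-separated subset of the unit sphere S_X of the Petty space, and set D₂ = {(x,y,z) ∈ S_X : 1/3 < z ≤ 1/2} and D₃ = {(x,y,z) ∈ S_X : 1/4 < z ≤ 1/3}. (i) If S ∩ D₃ has exactly 4 elements, then S ∩ D₂ = ∅. (ii) If S ∩ D₃ has exactly 3 elements, then S ∩ D₂ has at most 1 element. -/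
/-- A point of the upper half of the unit sphere in cylindrical coordinates, with its polar angle
measured from a prescribed direction `t₀`. -/
theorem exists_angle_of_mem_pettySphere {a : ℝ × ℝ × ℝ} (ha : a ∈ pettySphere) (hz : 0 ≤ a.2.2)
    (t₀ : ℝ) : ∃ t : ℝ, 0 ≤ t ∧ t < 2 * Real.pi ∧
      a.1 = (1 - a.2.2) * Real.cos (t₀ + t) ∧ a.2.1 = (1 - a.2.2) * Real.sin (t₀ + t) := by
  obtain ⟨x, y, z⟩ := a
  simp only [pettySphere, pettyNorm, Set.mem_ofPred_eq] at ha hz ⊢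
  rw [abs_of_nonneg hz] at ha
  have hnorm : ‖(⟨x, y⟩ : ℂ)‖ = 1 - z := by
    rw [Complex.norm_eq_sqrt_sq_add_sq]
    linarith
  have hx := Complex.norm_mul_cos_arg ⟨x, y⟩
  have hy := Complex.norm_mul_sin_arg ⟨x, y⟩
  rw [hnorm] at hx hy
  obtain ⟨n, ⟨hn₀, hn₁⟩, -⟩ := existsUnique_add_zsmul_mem_Ico Real.two_pi_pos
    (Complex.arg ⟨x, y⟩ - t₀) 0
  refine ⟨_, hn₀, by linarith, ?_⟩
  have hangle : t₀ + (Complex.arg ⟨x, y⟩ - t₀ + n • (2 * Real.pi)) =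
      Complex.arg ⟨x, y⟩ + n * (2 * Real.pi) := by
    rw [zsmul_eq_mul]
    ring
  rw [hangle, Real.cos_add_int_mul_two_pi, Real.sin_add_int_mul_two_pi]
  exact ⟨hx.symm, hy.symm⟩

/-- The law of cosines for two points of the unit sphere at Petty distance at least `1`. -/
theorem cos_sub_le_of_one_le_pettyDist_s7 {a b : ℝ × ℝ × ℝ} {s t : ℝ} (h : 1 ≤ pettyDist a b)
    (hab : |a.2.2 - b.2.2| ≤ 1)
    (ha₁ : a.1 = (1 - a.2.2) * Real.cos s) (ha₂ : a.2.1 = (1 - a.2.2) * Real.sin s)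
    (hb₁ : b.1 = (1 - b.2.2) * Real.cos t) (hb₂ : b.2.1 = (1 - b.2.2) * Real.sin t) :
    2 * ((1 - a.2.2) * (1 - b.2.2)) * Real.cos (s - t) ≤
      2 * ((1 - a.2.2) * (1 - b.2.2)) - 1 + 2 * |a.2.2 - b.2.2| := by
  simp only [pettyDist, pettyNorm, Prod.fst_sub, Prod.snd_sub] at h
  have hsqrt : (1 - |a.2.2 - b.2.2|) ^ 2 ≤ (a.1 - b.1) ^ 2 + (a.2.1 - b.2.1) ^ 2 :=
    (Real.le_sqrt (by linarith) (by positivity)).mp (by linarith)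
  rw [ha₁, ha₂, hb₁, hb₂] at hsqrt
  rw [Real.cos_sub]
  linear_combination hsqrt + (1 - a.2.2) ^ 2 * Real.sin_sq_add_cos_sq s +
    (1 - b.2.2) ^ 2 * Real.sin_sq_add_cos_sq t - sq_abs (a.2.2 - b.2.2)

theorem cos_sub_le_one_sixth {z w c : ℝ} (hz : 1 / 4 < z ∧ z ≤ 1 / 3) (hw : 1 / 4 < w ∧ w ≤ 1 / 3)
    (h : 2 * ((1 - z) * (1 - w)) * c ≤ 2 * ((1 - z) * (1 - w)) - 1 + 2 * |z - w|) :
    c ≤ 1 / 6 := by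
  have hpos : 0 < 2 * ((1 - z) * (1 - w)) := by nlinarith
  refine le_of_mul_le_mul_left (h.trans ?_) hpos
  rcases abs_cases (z - w) with ⟨h₁, h₂⟩ | ⟨h₁, h₂⟩ <;> rw [h₁] <;> nlinarith

theorem cos_sub_le_one_third {z w c : ℝ} (hz : 1 / 3 < z ∧ z ≤ 1 / 2) (hw : 1 / 4 < w ∧ w ≤ 1 / 3)
    (h : 2 * ((1 - z) * (1 - w)) * c ≤ 2 * ((1 - z) * (1 - w)) - 1 + 2 * |z - w|) :
    c ≤ 1 / 3 := by
  have hpos : 0 < 2 * ((1 - z) * (1 - w)) := by nlinarith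
  refine le_of_mul_le_mul_left (h.trans ?_) hpos
  rw [abs_of_pos (by linarith)]
  nlinarith

theorem cos_sub_nonpos {z w c : ℝ} (hz : 1 / 3 < z ∧ z ≤ 1 / 2) (hw : 1 / 3 < w ∧ w ≤ 1 / 2)
    (h : 2 * ((1 - z) * (1 - w)) * c ≤ 2 * ((1 - z) * (1 - w)) - 1 + 2 * |z - w|) :
    c ≤ 0 := by
  have hpos : 0 < 2 * ((1 - z) * (1 - w)) := by nlinarith
  refine le_of_mul_le_mul_left (h.trans ?_) hpos
  rcases abs_cases (z - w) with ⟨h₁, h₂⟩ | ⟨h₁, h₂⟩ <;> rw [h₁] <;> nlinarith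

theorem pi_div_two_sub_le_abs {x s : ℝ} (hs : 0 ≤ s) (h : Real.cos x ≤ Real.sin s) :
    Real.pi / 2 - s ≤ |x| := by
  by_contra! hlt
  have hcos := Real.cos_lt_cos_of_nonneg_of_le_pi (abs_nonneg x)
    (by linarith [Real.pi_pos]) hlt
  rw [Real.cos_abs, Real.cos_pi_div_two_sub] at hcos
  linarith

theorem le_abs_of_cos_le_one_sixth {x : ℝ} (h : Real.cos x ≤ 1 / 6) :
    Real.pi / 2 - 0.17 ≤ |x| := by
  refine pi_div_two_sub_le_abs (by norm_num) (h.trans ?_)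
  have := Real.sin_gt_sub_cube (x := 0.17) (by norm_num)
  norm_num at this ⊢
  linarith

theorem le_abs_of_cos_le_one_third {x : ℝ} (h : Real.cos x ≤ 1 / 3) :
    Real.pi / 2 - 0.35 ≤ |x| := by
  refine pi_div_two_sub_le_abs (by norm_num) (h.trans ?_)
  have := Real.sin_gt_sub_cube (x := 0.35) (by norm_num)
  norm_num at this ⊢
  linarith

theorem mem_Icc_of_cos_le_one_third {x : ℝ} (h₀ : 0 ≤ x) (h₁ : x < 2 * Real.pi)
    (h : Real.cos x ≤ 1 / 3) :
    x ∈ Set.Icc (Real.pi / 2 - 0.35) (2 * Real.pi - (Real.pi / 2 - 0.35)) := by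
  have hl := le_abs_of_cos_le_one_third h
  have hr := le_abs_of_cos_le_one_third ((Real.cos_two_pi_sub x).trans_le h)
  rw [abs_of_nonneg h₀] at hl
  rw [abs_of_pos (by linarith)] at hr
  exact ⟨hl, by linarith⟩

theorem mem_Icc_of_cos_nonpos {x : ℝ} (h₀ : 0 ≤ x) (h₁ : x < 2 * Real.pi)
    (h : Real.cos x ≤ 0) :
    x ∈ Set.Icc (Real.pi / 2) (2 * Real.pi - Real.pi / 2) := by
  have hl := pi_div_two_sub_le_abs le_rfl (h.trans_eq Real.sin_zero.symm)
  have hr := pi_div_two_sub_le_abs le_rfl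
    (((Real.cos_two_pi_sub x).trans_le h).trans_eq Real.sin_zero.symm)
  rw [abs_of_nonneg h₀] at hl
  rw [abs_of_pos (by linarith)] at hr
  exact ⟨by linarith, by linarith⟩

theorem not_separated_four_of_mem_Icc {l u β b₁ b₂ b₃ b₄ : ℝ} (hβ : u - l < 3 * β) (hβ₀ : 0 < β)
    (h₁ : b₁ ∈ Set.Icc l u) (h₂ : b₂ ∈ Set.Icc l u) (h₃ : b₃ ∈ Set.Icc l u)
    (h₄ : b₄ ∈ Set.Icc l u) (h₁₂ : β ≤ |b₁ - b₂|) (h₁₃ : β ≤ |b₁ - b₃|) (h₁₄ : β ≤ |b₁ - b₄|)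
    (h₂₃ : β ≤ |b₂ - b₃|) (h₂₄ : β ≤ |b₂ - b₄|) (h₃₄ : β ≤ |b₃ - b₄|) : False := by
  obtain ⟨_, _⟩ := h₁
  obtain ⟨_, _⟩ := h₂
  obtain ⟨_, _⟩ := h₃
  obtain ⟨_, _⟩ := h₄
  rw [le_abs] at *
  rcases h₁₂ with _ | _ <;> rcases h₁₃ with _ | _ <;> rcases h₂₃ with _ | _ <;>
    rcases h₁₄ with _ | _ <;> rcases h₂₄ with _ | _ <;> rcases h₃₄ with _ | _ <;> linarith

/-- Here `0` and `φ` are the directions of two points of `D₂`, and the `bᵢ` those of three points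
of `D₃`. -/
theorem not_separated_three_of_gap {φ b₁ b₂ b₃ : ℝ}
    (hφ : φ ∈ Set.Icc (Real.pi / 2) (2 * Real.pi - Real.pi / 2))
    (h₁ : b₁ ∈ Set.Icc (Real.pi / 2 - 0.35) (2 * Real.pi - (Real.pi / 2 - 0.35)))
    (h₂ : b₂ ∈ Set.Icc (Real.pi / 2 - 0.35) (2 * Real.pi - (Real.pi / 2 - 0.35)))
    (h₃ : b₃ ∈ Set.Icc (Real.pi / 2 - 0.35) (2 * Real.pi - (Real.pi / 2 - 0.35)))
    (hφ₁ : Real.pi / 2 - 0.35 ≤ |φ - b₁|) (hφ₂ : Real.pi / 2 - 0.35 ≤ |φ - b₂|)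
    (hφ₃ : Real.pi / 2 - 0.35 ≤ |φ - b₃|) (h₁₂ : Real.pi / 2 - 0.17 ≤ |b₁ - b₂|)
    (h₁₃ : Real.pi / 2 - 0.17 ≤ |b₁ - b₃|) (h₂₃ : Real.pi / 2 - 0.17 ≤ |b₂ - b₃|) : False := by
  have hpi := Real.pi_gt_d4
  obtain ⟨_, _⟩ := hφ
  obtain ⟨_, _⟩ := h₁
  obtain ⟨_, _⟩ := h₂
  obtain ⟨_, _⟩ := h₃
  rw [le_abs] at *
  rcases hφ₁ with _ | _ <;> rcases hφ₂ with _ | _ <;> rcases h₁₂ with _ | _ <;>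
    rcases hφ₃ with _ | _ <;> rcases h₁₃ with _ | _ <;> rcases h₂₃ with _ | _ <;> linarith

/-- Polar angles of the points of a separated set, measured from the direction of its member `a`. -/
theorem OneSeparated.exists_angle {S : Set (ℝ × ℝ × ℝ)} (hsep : OneSeparated S)
    (hS : S ⊆ pettySphere) {a : ℝ × ℝ × ℝ} (ha : a ∈ S) (hza : a.2.2 ∈ Set.Icc 0 1) :
    ∃ θ : ℝ × ℝ × ℝ → ℝ, θ a = 0 ∧
      (∀ b ∈ S, b.2.2 ∈ Set.Icc 0 1 → 0 ≤ θ b ∧ θ b < 2 * Real.pi) ∧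
      ∀ b ∈ S, ∀ c ∈ S, b ≠ c → b.2.2 ∈ Set.Icc 0 1 → c.2.2 ∈ Set.Icc 0 1 →
        2 * ((1 - b.2.2) * (1 - c.2.2)) * Real.cos (θ b - θ c) ≤
          2 * ((1 - b.2.2) * (1 - c.2.2)) - 1 + 2 * |b.2.2 - c.2.2| := by
  classical
  obtain ⟨t₀, -, -, hat⟩ := exists_angle_of_mem_pettySphere (hS ha) hza.1 0
  rw [zero_add, ← add_zero t₀] at hat
  have hex (b : ℝ × ℝ × ℝ) : ∃ t : ℝ, (b = a → t = 0) ∧ (b ∈ S → b.2.2 ∈ Set.Icc 0 1 →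
      0 ≤ t ∧ t < 2 * Real.pi ∧ b.1 = (1 - b.2.2) * Real.cos (t₀ + t) ∧
        b.2.1 = (1 - b.2.2) * Real.sin (t₀ + t)) := by
    by_cases hb : b = a
    · exact ⟨0, fun _ ↦ rfl, fun _ _ ↦ ⟨le_rfl, Real.two_pi_pos, hb ▸ hat⟩⟩
    by_cases hbS : b ∈ S ∧ b.2.2 ∈ Set.Icc 0 1
    · obtain ⟨t, ht⟩ := exists_angle_of_mem_pettySphere (hS hbS.1) hbS.2.1 t₀
      exact ⟨t, fun h ↦ absurd h hb, fun _ _ ↦ ht⟩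
    · exact ⟨0, fun _ ↦ rfl, fun h h' ↦ absurd ⟨h, h'⟩ hbS⟩
  choose θ hθa hθ using hex
  refine ⟨θ, hθa a rfl, fun b hb hzb ↦ ⟨(hθ b hb hzb).1, (hθ b hb hzb).2.1⟩,
    fun b hb c hc hbc hzb hzc ↦ ?_⟩
  obtain ⟨-, -, hb₁, hb₂⟩ := hθ b hb hzb
  obtain ⟨-, -, hc₁, hc₂⟩ := hθ c hc hzc
  have := cos_sub_le_of_one_le_pettyDist_s7 (hsep b hb c hc hbc)
    (abs_le.mpr ⟨by linarith [hzb.1, hzc.2], by linarith [hzb.2, hzc.1]⟩) hb₁ hb₂ hc₁ hc₂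
  rwa [add_sub_add_left_eq_sub] at this

/-- The angles of the previous lemma, for points of `D₂` and `D₃` measured from a point `a` of
`D₂`. -/
theorem OneSeparated.exists_angle_of_mem_D2 {S : Set (ℝ × ℝ × ℝ)} (hsep : OneSeparated S)
    (hS : S ⊆ pettySphere) {a : ℝ × ℝ × ℝ} (ha : a ∈ S) (hza : 1 / 3 < a.2.2 ∧ a.2.2 ≤ 1 / 2) :
    ∃ θ : ℝ × ℝ × ℝ → ℝ,
      (∀ b ∈ S, 1 / 4 < b.2.2 ∧ b.2.2 ≤ 1 / 3 →
        θ b ∈ Set.Icc (Real.pi / 2 - 0.35) (2 * Real.pi - (Real.pi / 2 - 0.35))) ∧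
      (∀ b ∈ S, 1 / 3 < b.2.2 ∧ b.2.2 ≤ 1 / 2 → b ≠ a →
        θ b ∈ Set.Icc (Real.pi / 2) (2 * Real.pi - Real.pi / 2)) ∧
      (∀ b ∈ S, ∀ c ∈ S, 1 / 4 < b.2.2 ∧ b.2.2 ≤ 1 / 3 → 1 / 4 < c.2.2 ∧ c.2.2 ≤ 1 / 3 →
        b ≠ c → Real.pi / 2 - 0.17 ≤ |θ b - θ c|) ∧
      ∀ b ∈ S, ∀ c ∈ S, 1 / 3 < b.2.2 ∧ b.2.2 ≤ 1 / 2 → 1 / 4 < c.2.2 ∧ c.2.2 ≤ 1 / 3 →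
        Real.pi / 2 - 0.35 ≤ |θ b - θ c| := by
  have low {z : ℝ} (hz : 1 / 4 < z ∧ z ≤ 1 / 3) : z ∈ Set.Icc (0 : ℝ) 1 :=
    ⟨by linarith, by linarith⟩
  have high {z : ℝ} (hz : 1 / 3 < z ∧ z ≤ 1 / 2) : z ∈ Set.Icc (0 : ℝ) 1 :=
    ⟨by linarith, by linarith⟩
  have ne {b c : ℝ × ℝ × ℝ} (hb : 1 / 3 < b.2.2 ∧ b.2.2 ≤ 1 / 2)
      (hc : 1 / 4 < c.2.2 ∧ c.2.2 ≤ 1 / 3) : b ≠ c := by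
    rintro rfl
    linarith
  obtain ⟨θ, hθa, hmem, hlaw⟩ := hsep.exists_angle hS ha (high hza)
  refine ⟨θ, fun b hb hzb ↦ ?_, fun b hb hzb hba ↦ ?_, fun b hb c hc hzb hzc hbc ↦ ?_,
    fun b hb c hc hzb hzc ↦ ?_⟩
  · have := hlaw a ha b hb (ne hza hzb) (high hza) (low hzb)
    rw [hθa, zero_sub, Real.cos_neg] at this
    obtain ⟨h₀, h₁⟩ := hmem b hb (low hzb)
    exact mem_Icc_of_cos_le_one_third h₀ h₁ (cos_sub_le_one_third hza hzb this)
  · have := hlaw b hb a ha hba (high hzb) (high hza)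
    rw [hθa, sub_zero] at this
    obtain ⟨h₀, h₁⟩ := hmem b hb (high hzb)
    exact mem_Icc_of_cos_nonpos h₀ h₁ (cos_sub_nonpos hzb hza this)
  · exact le_abs_of_cos_le_one_sixth
      (cos_sub_le_one_sixth hzb hzc (hlaw b hb c hc hbc (low hzb) (low hzc)))
  · exact le_abs_of_cos_le_one_third
      (cos_sub_le_one_third hzb hzc (hlaw b hb c hc (ne hzb hzc) (high hzb) (low hzc)))

/-- for a 1-separated subset S of the Petty unit sphere,
(i) |S ∩ D₃| = 4 → S ∩ D₂ = ∅ and (ii) |S ∩ D₃| = 3 → |S ∩ D₂| ≤ 1. -/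
theorem oneSeparated_D3_D2 (S : Set (ℝ × ℝ × ℝ)) (hsep : OneSeparated S)
    (hS : S ⊆ pettySphere) :
    ((S ∩ {a ∈ pettySphere | 1/4 < a.2.2 ∧ a.2.2 ≤ 1/3}).encard = 4 →
      S ∩ {a ∈ pettySphere | 1/3 < a.2.2 ∧ a.2.2 ≤ 1/2} = ∅) ∧
    ((S ∩ {a ∈ pettySphere | 1/4 < a.2.2 ∧ a.2.2 ≤ 1/3}).encard = 3 →
      (S ∩ {a ∈ pettySphere | 1/3 < a.2.2 ∧ a.2.2 ≤ 1/2}).encard ≤ 1) := by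
  constructor
  · intro h
    obtain ⟨b₁, b₂, b₃, b₄, h₁₂, h₁₃, h₁₄, h₂₃, h₂₄, h₃₄, hB⟩ := Set.encard_eq_four.mp h
    obtain ⟨hS₁, -, hz₁⟩ := hB.superset (show b₁ ∈ {b₁, b₂, b₃, b₄} by simp)
    obtain ⟨hS₂, -, hz₂⟩ := hB.superset (show b₂ ∈ {b₁, b₂, b₃, b₄} by simp)
    obtain ⟨hS₃, -, hz₃⟩ := hB.superset (show b₃ ∈ {b₁, b₂, b₃, b₄} by simp)
    obtain ⟨hS₄, -, hz₄⟩ := hB.superset (show b₄ ∈ {b₁, b₂, b₃, b₄} by simp)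
    refine Set.eq_empty_iff_forall_notMem.mpr fun a ⟨ha, _, hza⟩ ↦ ?_
    obtain ⟨θ, hmem, -, hsep₃, -⟩ := hsep.exists_angle_of_mem_D2 hS ha hza
    have hpi := Real.pi_gt_d4
    exact not_separated_four_of_mem_Icc (by linarith) (by linarith)
      (hmem _ hS₁ hz₁) (hmem _ hS₂ hz₂) (hmem _ hS₃ hz₃) (hmem _ hS₄ hz₄)
      (hsep₃ _ hS₁ _ hS₂ hz₁ hz₂ h₁₂) (hsep₃ _ hS₁ _ hS₃ hz₁ hz₃ h₁₃)
      (hsep₃ _ hS₁ _ hS₄ hz₁ hz₄ h₁₄) (hsep₃ _ hS₂ _ hS₃ hz₂ hz₃ h₂₃)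
      (hsep₃ _ hS₂ _ hS₄ hz₂ hz₄ h₂₄) (hsep₃ _ hS₃ _ hS₄ hz₃ hz₄ h₃₄)
  · intro h
    obtain ⟨b₁, b₂, b₃, h₁₂, h₁₃, h₂₃, hB⟩ := Set.encard_eq_three.mp h
    obtain ⟨hS₁, -, hz₁⟩ := hB.superset (show b₁ ∈ {b₁, b₂, b₃} by simp)
    obtain ⟨hS₂, -, hz₂⟩ := hB.superset (show b₂ ∈ {b₁, b₂, b₃} by simp)
    obtain ⟨hS₃, -, hz₃⟩ := hB.superset (show b₃ ∈ {b₁, b₂, b₃} by simp)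
    refine Set.encard_le_one_iff.mpr fun c a ⟨hc, _, hzc⟩ ⟨ha, _, hza⟩ ↦ ?_
    by_contra hca
    obtain ⟨θ, hmem, hmem₂, hsep₃, hsep₂⟩ := hsep.exists_angle_of_mem_D2 hS ha hza
    exact not_separated_three_of_gap (hmem₂ c hc hzc hca)
      (hmem _ hS₁ hz₁) (hmem _ hS₂ hz₂) (hmem _ hS₃ hz₃)
      (hsep₂ _ hc _ hS₁ hzc hz₁) (hsep₂ _ hc _ hS₂ hzc hz₂) (hsep₂ _ hc _ hS₃ hzc hz₃)
      (hsep₃ _ hS₁ _ hS₂ hz₁ hz₂ h₁₂) (hsep₃ _ hS₁ _ hS₃ hz₁ hz₃ h₁₃)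
      (hsep₃ _ hS₂ _ hS₃ hz₂ hz₃ h₂₃)
end

section
/- Let S be a 1-separated subset of the unit sphere S_X of the Petty space, and set D₂ = {(x,y,z) ∈ S_X : 1/3 < z ≤ 1/2}, D₃ = {(x,y,z) ∈ S_X : 1/4 < z ≤ 1/3} and D₄ = {(x,y,z) ∈ S_X : 0.245 < z ≤ 1/3}. (i) If S ∩ D₄ has at least 2 elements, then S ∩ D₂ has at most 2 elements. (ii) If S ∩ D₄ has at least 3 elements and S ∩ D₃ has exactly 2 elements, then S ∩ D₂ has at most 1 element. -/
open Real in
/-- A common rotation brings finitely many angles into `[0, 2π)` with a given one at the origin. -/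
theorem exists_rotation_Ico {ι : Type*} (θ : ι → ℝ) (i₀ : ι) :
    ∃ φ : ι → ℝ, φ i₀ = 0 ∧ (∀ i, φ i ∈ Set.Ico 0 (2 * π)) ∧
      ∀ i j, cos (φ i - φ j) = cos (θ i - θ j) := by
  refine ⟨fun i => toIcoMod two_pi_pos 0 (θ i - θ i₀), ?_, fun i => ?_, fun i j => ?_⟩
  · simp
  · simpa using toIcoMod_mem_Ico two_pi_pos 0 (θ i - θ i₀)
  · simp only [toIcoMod, zsmul_eq_mul]
    set m := toIcoDiv two_pi_pos 0 (θ i - θ i₀)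
    set n := toIcoDiv two_pi_pos 0 (θ j - θ i₀)
    rw [← cos_sub_int_mul_two_pi (θ i - θ j) (m - n)]
    congr 1
    push_cast
    ring

open Real in
theorem arccos_le_of_cos_le_s8 {c x : ℝ} (hx : 0 ≤ x) (h : cos x ≤ c) : arccos c ≤ x := by
  rcases le_total x π with hπ | hπ
  · rw [← arccos_cos hx hπ]
    exact arccos_le_arccos h
  · exact (arccos_le_pi c).trans hπ

open Real in
theorem arccos_le_abs_sub_of_cos_le {c x y : ℝ} (hx : x ∈ Set.Ico 0 (2 * π))
    (hy : y ∈ Set.Ico 0 (2 * π)) (h : cos (x - y) ≤ c) :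
    arccos c ≤ |x - y| ∧ |x - y| ≤ 2 * π - arccos c := by
  have hlt : |x - y| ≤ 2 * π := abs_le.2 ⟨by linarith [hx.1, hy.2], by linarith [hx.2, hy.1]⟩
  rw [← cos_abs] at h
  refine ⟨arccos_le_of_cos_le_s8 (abs_nonneg _) h, ?_⟩
  rw [← cos_two_pi_sub] at h
  linarith [arccos_le_of_cos_le_s8 (sub_nonneg.2 hlt) h]

open Real in
/-- A lower bound for the sum of two arccosines, by the addition formula. -/
theorem lt_arccos_add_arccos {a b s d : ℝ} (ha : 0 ≤ a) (hb : 0 ≤ b) (ha1 : a ≤ 1) (hb1 : b ≤ 1)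
    (hsab : s ^ 2 ≤ (1 - a ^ 2) * (1 - b ^ 2)) (hd : d ≤ π)
    (h : a * b - s < cos d) : d < arccos a + arccos b := by
  by_contra! hle
  have hcos := cos_le_cos_of_nonneg_of_le_pi
    (add_nonneg (arccos_nonneg a) (arccos_nonneg b)) hd hle
  rw [cos_add, cos_arccos (by linarith) ha1, cos_arccos (by linarith) hb1, sin_arccos, sin_arccos,
    ← sqrt_mul (by nlinarith)] at hcos
  linarith [le_sqrt_of_sq_le hsab]

open Real in
theorem three_pi_div_eight_lt_arccos : 3 * π / 8 < arccos 0.351 := by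
  have h : 3 * π / 4 < arccos 0.351 + arccos 0.351 := by
    refine lt_arccos_add_arccos (s := 0.8767) (by norm_num) (by norm_num) (by norm_num)
      (by norm_num) (by norm_num) (by linarith [pi_pos]) ?_
    rw [show 3 * π / 4 = π - π / 4 by ring, cos_pi_sub, cos_pi_div_four]
    have : √2 < 1.42 := by rw [sqrt_lt' (by norm_num)]; norm_num
    linarith
  linarith

open Real in
theorem two_pi_lt_of_opposite_gap :
    2 * π < 2 * arccos 0.351 + 2 * arccos (1 / 3) + arccos (1 / 6) := by
  have h : π - arccos (1 / 6) / 2 < arccos 0.351 + arccos (1 / 3) := by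
    refine lt_arccos_add_arccos (s := 0.8828) (by norm_num) (by norm_num) (by norm_num)
      (by norm_num) (by norm_num) (by linarith [arccos_nonneg (1 / 6)]) ?_
    rw [cos_pi_sub, cos_half (by linarith [arccos_nonneg (1 / 6), pi_pos]) (arccos_le_pi _),
      cos_arccos (by norm_num) (by norm_num)]
    have : √((1 + 1 / 6) / 2) < 0.765 := by rw [sqrt_lt' (by norm_num)]; norm_num
    linarith
  linarith

open Real in
theorem two_pi_lt_of_adjacent_gap :
    2 * π < arccos 0.351 + 3 * arccos (1 / 3) + arccos 0.18213 := by
  have h : 2 * π - 3 * arccos (1 / 3) < arccos 0.351 + arccos 0.18213 := by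
    refine lt_arccos_add_arccos (s := 0.92) (by norm_num) (by norm_num) (by norm_num)
      (by norm_num) (by norm_num) ?_ ?_
    · have : arccos (1 / 2) ≤ arccos (1 / 3) := arccos_le_arccos (by norm_num)
      have h3 : arccos (1 / 2) = π / 3 := by
        rw [← cos_pi_div_three, arccos_cos (by linarith [pi_pos]) (by linarith [pi_pos])]
      linarith
    · rw [cos_two_pi_sub, cos_three_mul, cos_arccos (by norm_num) (by norm_num)]
      norm_num
  linarith

open Real in
/-- Five directions, three of them pairwise at least `π / 2` apart, cannot all be pairwise
`arccos 0.351` apart. -/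
theorem not_five_directions_of_three_orthogonal (t : Fin 5 → ℝ)
    (h : ∀ i j, i < j → cos (t i - t j) ≤ 0.351)
    (h01 : cos (t 0 - t 1) ≤ 0) (h02 : cos (t 0 - t 2) ≤ 0) (h12 : cos (t 1 - t 2) ≤ 0) :
    False := by
  obtain ⟨φ, h0, hφ, hcos⟩ := exists_rotation_Ico t 0
  have key {i j c} (hc : cos (t i - t j) ≤ c) :=
    arccos_le_abs_sub_of_cos_le (hφ i) (hφ j) ((hcos i j).trans_le hc)
  have ha := three_pi_div_eight_lt_arccos
  have g01 := key h01
  have g02 := key h02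
  have g12 := key h12
  have g03 := key (h 0 3 (by decide))
  have g04 := key (h 0 4 (by decide))
  have g13 := key (h 1 3 (by decide))
  have g14 := key (h 1 4 (by decide))
  have g23 := key (h 2 3 (by decide))
  have g24 := key (h 2 4 (by decide))
  have g34 := key (h 3 4 (by decide))
  rw [h0, zero_sub, abs_neg, abs_of_nonneg (hφ _).1] at g01 g02 g03 g04
  rw [arccos_zero] at g01 g02 g12
  clear key hcos hφ h h01 h02 h12
  have hπ := pi_pos
  replace g12 := le_abs.1 g12.1
  replace g13 := le_abs.1 g13.1
  replace g14 := le_abs.1 g14.1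
  replace g23 := le_abs.1 g23.1
  replace g24 := le_abs.1 g24.1
  replace g34 := le_abs.1 g34.1
  rcases g12 with h12 | h12 <;> rcases g34 with h34 | h34 <;>
  rcases g13 with h13 | h13 <;> rcases g14 with h14 | h14 <;>
  rcases g23 with h23 | h23 <;> rcases g24 with h24 | h24 <;>
  linarith

set_option maxHeartbeats 1000000 in
open Real in
/-- The directions `0, 1` lie at large height, `2, 3` at medium height and `4` at low height. -/
theorem not_five_directions_of_two_two_one (t : Fin 5 → ℝ)
    (h01 : cos (t 0 - t 1) ≤ 0) (h02 : cos (t 0 - t 2) ≤ 1 / 3) (h03 : cos (t 0 - t 3) ≤ 1 / 3)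
    (h12 : cos (t 1 - t 2) ≤ 1 / 3) (h13 : cos (t 1 - t 3) ≤ 1 / 3)
    (h04 : cos (t 0 - t 4) ≤ 0.351) (h14 : cos (t 1 - t 4) ≤ 0.351)
    (h23 : cos (t 2 - t 3) ≤ 1 / 6)
    (h24 : cos (t 2 - t 4) ≤ 0.18213) (h34 : cos (t 3 - t 4) ≤ 0.18213) :
    False := by
  obtain ⟨φ, h0, hφ, hcos⟩ := exists_rotation_Ico t 0
  have key {i j c} (hc : cos (t i - t j) ≤ c) :=
    arccos_le_abs_sub_of_cos_le (hφ i) (hφ j) ((hcos i j).trans_le hc)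
  have ha := three_pi_div_eight_lt_arccos
  have hopp := two_pi_lt_of_opposite_gap
  have hadj := two_pi_lt_of_adjacent_gap
  have hαβ : arccos 0.351 ≤ arccos (1 / 3) := arccos_le_arccos (by norm_num)
  have hαε : arccos 0.351 ≤ arccos 0.18213 := arccos_le_arccos (by norm_num)
  have hεγ : arccos 0.18213 ≤ arccos (1 / 6) := arccos_le_arccos (by norm_num)
  have g01 := key h01
  have g02 := key h02
  have g12 := key h12
  have g03 := key h03
  have g04 := key h04
  have g13 := key h13
  have g14 := key h14
  have g23 := key h23
  have g24 := key h24
  have g34 := key h34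
  rw [h0, zero_sub, abs_neg, abs_of_nonneg (hφ _).1] at g01 g02 g03 g04
  rw [arccos_zero] at g01
  clear key hcos hφ h01 h02 h03 h04 h12 h13 h14 h23 h24 h34
  have hπ := pi_pos
  replace g12 := le_abs.1 g12.1
  replace g13 := le_abs.1 g13.1
  replace g14 := le_abs.1 g14.1
  replace g23 := le_abs.1 g23.1
  replace g24 := le_abs.1 g24.1
  replace g34 := le_abs.1 g34.1
  rcases g12 with h12 | h12 <;> rcases g34 with h34 | h34 <;>
  rcases g13 with h13 | h13 <;> rcases g14 with h14 | h14 <;>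
  rcases g23 with h23 | h23 <;> rcases g24 with h24 | h24 <;>
  linarith

/-- The direction of the horizontal part of a point of the Petty space. -/
noncomputable def pettyArg (a : ℝ × ℝ × ℝ) : ℝ := Complex.arg ⟨a.1, a.2.1⟩

open Real in
theorem sqrt_mul_sqrt_mul_cos_pettyArg_sub (a b : ℝ × ℝ × ℝ) :
    √(a.1 ^ 2 + a.2.1 ^ 2) * √(b.1 ^ 2 + b.2.1 ^ 2) * cos (pettyArg a - pettyArg b) =
      a.1 * b.1 + a.2.1 * b.2.1 := by
  have hn (p : ℝ × ℝ × ℝ) : √(p.1 ^ 2 + p.2.1 ^ 2) = ‖(⟨p.1, p.2.1⟩ : ℂ)‖ := by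
    rw [Complex.norm_def, Complex.normSq_apply, sq, sq]
  have hc (p : ℝ × ℝ × ℝ) : √(p.1 ^ 2 + p.2.1 ^ 2) * cos (pettyArg p) = p.1 := by
    rw [hn]; exact Complex.norm_mul_cos_arg _
  have hs (p : ℝ × ℝ × ℝ) : √(p.1 ^ 2 + p.2.1 ^ 2) * sin (pettyArg p) = p.2.1 := by
    rw [hn]; exact Complex.norm_mul_sin_arg _
  rw [cos_sub]
  linear_combination √(b.1 ^ 2 + b.2.1 ^ 2) * cos (pettyArg b) * hc a + a.1 * hc b +
    √(b.1 ^ 2 + b.2.1 ^ 2) * sin (pettyArg b) * hs a + a.2.1 * hs b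

open Real in
/-- The angular separation of two points at Petty distance at least `1` on the unit sphere. -/
theorem cos_pettyArg_sub_le {a b : ℝ × ℝ × ℝ} {c : ℝ} (ha : a ∈ pettySphere)
    (hb : b ∈ pettySphere) (hab : 1 ≤ pettyDist a b) (ha0 : 0 ≤ a.2.2) (hb0 : 0 ≤ b.2.2)
    (ha1 : a.2.2 < 1) (hb1 : b.2.2 < 1)
    (h : 2 * (1 - c) * ((1 - a.2.2) * (1 - b.2.2)) ≤ 1 - 2 * |a.2.2 - b.2.2|) :
    cos (pettyArg a - pettyArg b) ≤ c := by
  have hcos := sqrt_mul_sqrt_mul_cos_pettyArg_sub a b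
  have hra : √(a.1 ^ 2 + a.2.1 ^ 2) = 1 - a.2.2 := by
    have : pettyNorm a = 1 := ha
    rw [pettyNorm, abs_of_nonneg ha0] at this
    linarith
  have hrb : √(b.1 ^ 2 + b.2.1 ^ 2) = 1 - b.2.2 := by
    have : pettyNorm b = 1 := hb
    rw [pettyNorm, abs_of_nonneg hb0] at this
    linarith
  have hra2 := sq_sqrt (by positivity : 0 ≤ a.1 ^ 2 + a.2.1 ^ 2)
  have hrb2 := sq_sqrt (by positivity : 0 ≤ b.1 ^ 2 + b.2.1 ^ 2)
  rw [hra, hrb] at hcos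
  rw [hra] at hra2
  rw [hrb] at hrb2
  have hd : |a.2.2 - b.2.2| ≤ 1 := abs_le.2 ⟨by linarith, by linarith⟩
  have hchord : 1 - |a.2.2 - b.2.2| ≤ √((a.1 - b.1) ^ 2 + (a.2.1 - b.2.1) ^ 2) := by
    have : 1 ≤ √((a.1 - b.1) ^ 2 + (a.2.1 - b.2.1) ^ 2) + |a.2.2 - b.2.2| := hab
    linarith
  have hsq := (Real.le_sqrt (by linarith) (by positivity)).1 hchord
  have hpos : 0 < (1 - a.2.2) * (1 - b.2.2) := mul_pos (by linarith) (by linarith)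
  refine le_of_mul_le_mul_left ?_ hpos
  nlinarith [sq_abs (a.2.2 - b.2.2)]

/-- The height inequality behind the angular bounds, which is extremal at `(m, M)`. -/
theorem height_bound {c m M u v : ℝ} (hm : 0 ≤ m) (hM : M ≤ 1 / 2) (hc0 : 0 ≤ c) (hc1 : c ≤ 1 / 2)
    (hu : m ≤ u) (huM : u ≤ M) (hv : m ≤ v) (hvM : v ≤ M)
    (h : 2 * (1 - c) * ((1 - m) * (1 - M)) ≤ 1 - 2 * (M - m)) :
    2 * (1 - c) * ((1 - u) * (1 - v)) ≤ 1 - 2 * |u - v| := by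
  wlog huv : v ≤ u generalizing u v
  · rw [abs_sub_comm, mul_comm (1 - u)]
    exact this hv hvM hu huM (le_of_not_ge huv)
  rw [abs_of_nonneg (sub_nonneg.2 huv)]
  have hu' : 0 ≤ (M - u) * (1 - (1 - c) * (1 - m)) := mul_nonneg (by linarith) (by nlinarith)
  have hv' : 0 ≤ (v - m) * (1 + (1 - c) * (1 - u)) :=
    mul_nonneg (by linarith) (by nlinarith)
  nlinarith

open Real in
theorem cos_pettyArg_sub_le_of_mem_Icc {a b : ℝ × ℝ × ℝ} (c m M : ℝ) (ha : a ∈ pettySphere)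
    (hb : b ∈ pettySphere) (hab : 1 ≤ pettyDist a b) (hm : 0 ≤ m) (hM : M ≤ 1 / 2)
    (hc0 : 0 ≤ c) (hc1 : c ≤ 1 / 2)
    (ham : m ≤ a.2.2) (haM : a.2.2 ≤ M) (hbm : m ≤ b.2.2) (hbM : b.2.2 ≤ M)
    (h : 2 * (1 - c) * ((1 - m) * (1 - M)) ≤ 1 - 2 * (M - m)) :
    cos (pettyArg a - pettyArg b) ≤ c :=
  cos_pettyArg_sub_le ha hb hab (by linarith) (by linarith) (by linarith) (by linarith)
    (height_bound hm hM hc0 hc1 ham haM hbm hbM h)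

theorem exists_three_mem_of_two_lt_encard {α : Type*} {s : Set α} (h : 2 < s.encard) :
    ∃ a b c, a ∈ s ∧ b ∈ s ∧ c ∈ s ∧ a ≠ b ∧ a ≠ c ∧ b ≠ c := by
  have h3 : (3 : ℕ∞) ≤ s.encard := by
    simpa [two_add_one_eq_three] using Order.add_one_le_of_lt h
  obtain ⟨t, hts, ht⟩ := Set.exists_subset_encard_eq h3
  obtain ⟨a, b, c, hab, hac, hbc, rfl⟩ := Set.encard_eq_three.1 ht
  exact ⟨a, b, c, hts (by simp), hts (by simp), hts (by simp), hab, hac, hbc⟩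

/-- for a 1-separated subset S of the Petty unit sphere,
(i) |S ∩ D₄| ≥ 2 → |S ∩ D₂| ≤ 2 and (ii) |S ∩ D₄| ≥ 3 ∧ |S ∩ D₃| = 2 → |S ∩ D₂| ≤ 1. -/
theorem oneSeparated_D4_D3_D2 (S : Set (ℝ × ℝ × ℝ)) (hsep : OneSeparated S)
    (hS : S ⊆ pettySphere) :
    (2 ≤ (S ∩ {a ∈ pettySphere | 0.245 < a.2.2 ∧ a.2.2 ≤ 1/3}).encard →
      (S ∩ {a ∈ pettySphere | 1/3 < a.2.2 ∧ a.2.2 ≤ 1/2}).encard ≤ 2) ∧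
    (3 ≤ (S ∩ {a ∈ pettySphere | 0.245 < a.2.2 ∧ a.2.2 ≤ 1/3}).encard →
      (S ∩ {a ∈ pettySphere | 1/4 < a.2.2 ∧ a.2.2 ≤ 1/3}).encard = 2 →
      (S ∩ {a ∈ pettySphere | 1/3 < a.2.2 ∧ a.2.2 ≤ 1/2}).encard ≤ 1) := by
  have bound {a b : ℝ × ℝ × ℝ} (c m M : ℝ) (ha : a ∈ S) (hb : b ∈ S) (hab : a ≠ b) :=
    cos_pettyArg_sub_le_of_mem_Icc c m M (hS ha) (hS hb) (hsep a ha b hb hab)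
  refine ⟨fun h4 => ?_, fun h4 h3 => ?_⟩
  · by_contra! h2
    obtain ⟨d, e, ⟨hd, -, hd1, hd2⟩, ⟨he, -, he1, he2⟩, hde⟩ :=
      Set.one_lt_encard_iff.1 (lt_of_lt_of_le (by norm_num) h4)
    obtain ⟨a, b, c, ⟨ha, -, ha1, ha2⟩, ⟨hb, -, hb1, hb2⟩, ⟨hc, -, hc1, hc2⟩, hab, hac, hbc⟩ :=
      exists_three_mem_of_two_lt_encard h2
    have ne {p q : ℝ × ℝ × ℝ} (hp : 1 / 3 < p.2.2) (hq : q.2.2 ≤ 1 / 3) : p ≠ q := by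
      rintro rfl
      linarith
    have orth {p q : ℝ × ℝ × ℝ} (hp : p ∈ S) (hq : q ∈ S) (hpq : p ≠ q) (hp1 : 1 / 3 < p.2.2)
        (hp2 : p.2.2 ≤ 1 / 2) (hq1 : 1 / 3 < q.2.2) (hq2 : q.2.2 ≤ 1 / 2) :=
      bound 0 (1 / 3) (1 / 2) hp hq hpq (by norm_num) (by norm_num) (by norm_num) (by norm_num)
        hp1.le hp2 hq1.le hq2 (by norm_num)
    have hmem : ∀ i, (![a, b, c, d, e] i) ∈ S := by
      intro i
      fin_cases i <;> assumption
    have hheight : ∀ i, 0.245 ≤ (![a, b, c, d, e] i).2.2 ∧ (![a, b, c, d, e] i).2.2 ≤ 1 / 2 := by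
      intro i
      fin_cases i <;> constructor <;> simp <;> linarith
    have hne : ∀ i j : Fin 5, i < j → ![a, b, c, d, e] i ≠ ![a, b, c, d, e] j := by
      intro i j hij
      fin_cases i <;> fin_cases j <;> first
        | exact absurd hij (by decide)
        | assumption
        | exact ne (by assumption) (by assumption)
    refine not_five_directions_of_three_orthogonal (fun i => pettyArg (![a, b, c, d, e] i))
      (fun i j hij => bound 0.351 0.245 (1 / 2) (hmem i) (hmem j) (hne i j hij)
        (by norm_num) (by norm_num) (by norm_num) (by norm_num) (hheight i).1 (hheight i).2
        (hheight j).1 (hheight j).2 (by norm_num)) ?_ ?_ ?_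
    · exact orth ha hb hab ha1 ha2 hb1 hb2
    · exact orth ha hc hac ha1 ha2 hc1 hc2
    · exact orth hb hc hbc hb1 hb2 hc1 hc2
  · by_contra! h2
    obtain ⟨a, b, ⟨ha, -, ha1, ha2⟩, ⟨hb, -, hb1, hb2⟩, hab⟩ := Set.one_lt_encard_iff.1 h2
    obtain ⟨c, d, ⟨hc, -, hc1, hc2⟩, ⟨hd, -, hd1, hd2⟩, hcd⟩ :=
      Set.one_lt_encard_iff.1 (lt_of_lt_of_le (by norm_num) h3.ge)
    obtain ⟨e, ⟨he, hes, he1, he2⟩, hnot⟩ :=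
      Set.not_subset.1 fun hsub => (h4.trans ((Set.encard_le_encard hsub).trans h3.le)).not_gt
        (by norm_num)
    have he3 : e.2.2 ≤ 1 / 4 := by
      by_contra! hlt
      exact hnot ⟨he, hes, hlt, he2⟩
    have ne {p q : ℝ × ℝ × ℝ} (h : q.2.2 < p.2.2) : p ≠ q := by
      rintro rfl
      exact h.false
    refine not_five_directions_of_two_two_one
      ![pettyArg a, pettyArg b, pettyArg c, pettyArg d, pettyArg e]
      (bound _ (1 / 3) (1 / 2) ha hb hab ?_ ?_ ?_ ?_ ?_ ?_ ?_ ?_ ?_)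
      (bound _ (1 / 4) (1 / 2) ha hc (ne ?_) ?_ ?_ ?_ ?_ ?_ ?_ ?_ ?_ ?_)
      (bound _ (1 / 4) (1 / 2) ha hd (ne ?_) ?_ ?_ ?_ ?_ ?_ ?_ ?_ ?_ ?_)
      (bound _ (1 / 4) (1 / 2) hb hc (ne ?_) ?_ ?_ ?_ ?_ ?_ ?_ ?_ ?_ ?_)
      (bound _ (1 / 4) (1 / 2) hb hd (ne ?_) ?_ ?_ ?_ ?_ ?_ ?_ ?_ ?_ ?_)
      (bound _ 0.245 (1 / 2) ha he (ne ?_) ?_ ?_ ?_ ?_ ?_ ?_ ?_ ?_ ?_)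
      (bound _ 0.245 (1 / 2) hb he (ne ?_) ?_ ?_ ?_ ?_ ?_ ?_ ?_ ?_ ?_)
      (bound _ (1 / 4) (1 / 3) hc hd hcd ?_ ?_ ?_ ?_ ?_ ?_ ?_ ?_ ?_)
      (bound _ 0.245 (1 / 3) hc he (ne ?_) ?_ ?_ ?_ ?_ ?_ ?_ ?_ ?_ ?_)
      (bound _ 0.245 (1 / 3) hd he (ne ?_) ?_ ?_ ?_ ?_ ?_ ?_ ?_ ?_ ?_) <;> linarith
end

section
/- Let 1/2 > z₁ ≥ 0 ≥ z₂ > −1/2 and let z ∈ [−1/2, 1/2] with z₂ ≤ z ≤ z₁. Then the sum of 1-angular distances θ(z₁, z) + θ(z, z₂) is minimized at z = 0; that is, θ(z₁, z) + θ(z, z₂) ≥ θ(z₁, 0) + θ(0, z₂). -/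
theorem oneAngularDist_comm (x y : ℝ) : oneAngularDist x y = oneAngularDist y x := by
  unfold oneAngularDist
  rw [abs_sub_comm x y]
  congr 1
  ring

theorem oneAngularDist_neg_neg_s11 (x y : ℝ) : oneAngularDist (-x) (-y) = oneAngularDist x y := by
  unfold oneAngularDist
  rw [abs_neg, abs_neg, show -x - -y = -(x - y) by ring, abs_neg]

/-- The 1-angular distance of two heights in the same half-space. -/
theorem oneAngularDist_of_nonneg_of_le {a t : ℝ} (ht : 0 ≤ t) (hta : t ≤ a) :
    oneAngularDist a t = Real.arccos ((1 - 4 * t + 2 * a * t) / (2 * (1 - a) * (1 - t))) := by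
  unfold oneAngularDist
  rw [abs_of_nonneg (ht.trans hta), abs_of_nonneg ht, abs_of_nonneg (sub_nonneg.2 hta)]
  congr 2
  ring

/-- The 1-angular distance of two heights in opposite half-spaces. -/
theorem oneAngularDist_neg_of_nonneg {t b : ℝ} (ht : 0 ≤ t) (hb : 0 ≤ b) :
    oneAngularDist t (-b) = Real.arccos ((1 - 2 * b * t) / (2 * (1 - b) * (1 - t))) := by
  unfold oneAngularDist
  rw [abs_neg, abs_of_nonneg hb, abs_of_nonneg ht, abs_of_nonneg (by linarith)]
  congr 1
  ring

theorem hasDerivAt_affine_div_affine {p k t : ℝ} (hk : k ≠ 0) (ht : 1 - t ≠ 0) :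
    HasDerivAt (fun s : ℝ => (1 + p * s) / (2 * k * (1 - s)))
      ((1 + p) / (2 * k * (1 - t) ^ 2)) t := by
  have hn : HasDerivAt (fun s : ℝ => 1 + p * s) p t := by
    simpa using ((hasDerivAt_id t).const_mul p).const_add 1
  have hd : HasDerivAt (fun s : ℝ => 2 * k * (1 - s)) (-(2 * k)) t := by
    simpa using ((hasDerivAt_id t).const_sub 1).const_mul (2 * k)
  refine (hn.div hd (by positivity)).congr_deriv ?_
  field_simp
  ring

theorem monotoneOn_arccos_add_arccos {a b : ℝ} (ha : a < 1 / 2) (hb : b < 1 / 2) :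
    MonotoneOn (fun t : ℝ =>
      Real.arccos ((1 - 4 * t + 2 * a * t) / (2 * (1 - a) * (1 - t))) +
        Real.arccos ((1 - 2 * b * t) / (2 * (1 - b) * (1 - t)))) (Set.Icc 0 a) := by
  have ka : 0 < 1 - a := by linarith
  have kb : 0 < 1 - b := by linarith
  have hf {t : ℝ} (ht : 0 < 1 - t) :
      HasDerivAt (fun s : ℝ => (1 - 4 * s + 2 * a * s) / (2 * (1 - a) * (1 - s)))
        (-((3 - 2 * a) / (2 * (1 - a) * (1 - t) ^ 2))) t := by
    convert hasDerivAt_affine_div_affine (p := 2 * a - 4) ka.ne' ht.ne' using 1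
    · funext s; ring
    · ring
  have hg {t : ℝ} (ht : 0 < 1 - t) :
      HasDerivAt (fun s : ℝ => (1 - 2 * b * s) / (2 * (1 - b) * (1 - s)))
        ((1 - 2 * b) / (2 * (1 - b) * (1 - t) ^ 2)) t := by
    convert hasDerivAt_affine_div_affine (p := -2 * b) kb.ne' ht.ne' using 1
    · funext s; ring
    · ring
  refine monotoneOn_of_deriv_nonneg (convex_Icc 0 a) ?_ ?_ ?_
  · intro t ht
    have kt : 0 < 1 - t := by linarith [ht.2]
    exact ((Real.continuous_arccos.continuousAt.comp (hf kt).continuousAt).add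
      (Real.continuous_arccos.continuousAt.comp (hg kt).continuousAt)).continuousWithinAt
  all_goals
    intro t ht
    rw [interior_Icc] at ht
    obtain ⟨ht0, hta⟩ := ht
    have kt : 0 < 1 - t := by linarith
    have k2t : 0 < 1 - 2 * t := by linarith
    have k2b : 0 < 1 - 2 * b := by linarith
    have k3a : 0 < 3 - 2 * a := by linarith
    have kat : 0 < 1 - 2 * a + 2 * t := by linarith
    have ktb : 0 < 3 - 2 * t - 2 * b := by linarith
    have hF : 1 - ((1 - 4 * t + 2 * a * t) / (2 * (1 - a) * (1 - t))) ^ 2 =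
        (1 - 2 * a + 2 * t) * (3 - 2 * a) * (1 - 2 * t) / (2 * (1 - a) * (1 - t)) ^ 2 := by
      field_simp
      ring
    have hG : 1 - ((1 - 2 * b * t) / (2 * (1 - b) * (1 - t))) ^ 2 =
        (1 - 2 * t) * (1 - 2 * b) * (3 - 2 * t - 2 * b) / (2 * (1 - b) * (1 - t)) ^ 2 := by
      field_simp
      ring
    have hF0 : 0 < 1 - ((1 - 4 * t + 2 * a * t) / (2 * (1 - a) * (1 - t))) ^ 2 := by
      rw [hF]; positivity
    have hG0 : 0 < 1 - ((1 - 2 * b * t) / (2 * (1 - b) * (1 - t))) ^ 2 := by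
      rw [hG]; positivity
    have hd := ((Real.hasDerivAt_arccos (by intro h; norm_num [h] at hF0)
      (by intro h; norm_num [h] at hF0)).comp t (hf kt)).add
      ((Real.hasDerivAt_arccos (by intro h; norm_num [h] at hG0)
      (by intro h; norm_num [h] at hG0)).comp t (hg kt))
  · exact hd.differentiableAt.differentiableWithinAt
  · refine le_of_le_of_eq ?_ hd.deriv.symm
    have key : (1 - 2 * b) / (2 * (1 - b) * (1 - t) ^ 2) /
          √(1 - ((1 - 2 * b * t) / (2 * (1 - b) * (1 - t))) ^ 2) ≤
        (3 - 2 * a) / (2 * (1 - a) * (1 - t) ^ 2) /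
          √(1 - ((1 - 4 * t + 2 * a * t) / (2 * (1 - a) * (1 - t))) ^ 2) := by
      refine le_of_sq_le_sq ?_ (by positivity)
      rw [div_pow, div_pow _ (√_), Real.sq_sqrt hF0.le, Real.sq_sqrt hG0.le, hF, hG]
      have e₁ : ((1 - 2 * b) / (2 * (1 - b) * (1 - t) ^ 2)) ^ 2 /
          ((1 - 2 * t) * (1 - 2 * b) * (3 - 2 * t - 2 * b) / (2 * (1 - b) * (1 - t)) ^ 2) =
          (1 - 2 * b) / (3 - 2 * t - 2 * b) / ((1 - t) ^ 2 * (1 - 2 * t)) := by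
        field_simp
      have e₂ : ((3 - 2 * a) / (2 * (1 - a) * (1 - t) ^ 2)) ^ 2 /
          ((1 - 2 * a + 2 * t) * (3 - 2 * a) * (1 - 2 * t) / (2 * (1 - a) * (1 - t)) ^ 2) =
          (3 - 2 * a) / (1 - 2 * a + 2 * t) / ((1 - t) ^ 2 * (1 - 2 * t)) := by
        field_simp
      rw [e₁, e₂]
      gcongr ?_ / _
      exact ((div_le_one ktb).2 (by linarith)).trans ((one_le_div kat).2 (by linarith))
    simp only [div_eq_mul_inv] at key ⊢
    linarith

theorem oneAngularDist_add_le_of_nonneg {a b t : ℝ} (ha : a < 1 / 2) (hb0 : 0 ≤ b)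
    (hb : b < 1 / 2) (ht : 0 ≤ t) (hta : t ≤ a) :
    oneAngularDist a 0 + oneAngularDist 0 (-b) ≤
      oneAngularDist a t + oneAngularDist t (-b) := by
  rw [oneAngularDist_of_nonneg_of_le le_rfl (ht.trans hta), oneAngularDist_of_nonneg_of_le ht hta,
    oneAngularDist_neg_of_nonneg le_rfl hb0, oneAngularDist_neg_of_nonneg ht hb0]
  exact monotoneOn_arccos_add_arccos ha hb ⟨le_rfl, ht.trans hta⟩ ⟨ht, hta⟩ ht

/-- for 1/2 > z₁ ≥ 0 ≥ z₂ > −1/2 and z₂ ≤ z ≤ z₁, the sum of 1-angular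
distances θ(z₁, z) + θ(z, z₂) is minimized at z = 0. -/
theorem sum_oneAngularDist_min_at_zero (z₁ z₂ z : ℝ)
    (h₁ : z₁ < 1/2) (h₂ : 0 ≤ z₁) (h₃ : z₂ ≤ 0) (h₄ : -(1/2) < z₂)
    (h₅ : z₂ ≤ z) (h₆ : z ≤ z₁) :
    oneAngularDist z₁ 0 + oneAngularDist 0 z₂ ≤
      oneAngularDist z₁ z + oneAngularDist z z₂ := by
  rcases le_total 0 z with hz | hz
  · simpa using oneAngularDist_add_le_of_nonneg (b := -z₂) h₁ (by linarith) (by linarith) hz h₆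
  · have h := oneAngularDist_add_le_of_nonneg (a := -z₂) (b := z₁) (t := -z)
      (by linarith) h₂ h₁ (by linarith) (by linarith)
    have e (x : ℝ) : oneAngularDist (-x) 0 = oneAngularDist x 0 := by
      simpa using oneAngularDist_neg_neg_s11 x 0
    rw [e, oneAngularDist_comm 0 (-z₁), e, oneAngularDist_neg_neg_s11, oneAngularDist_neg_neg_s11,
      oneAngularDist_comm z₂ z, oneAngularDist_comm z z₁, oneAngularDist_comm z₂ 0] at h
    linarith
end

section
/- Let S be a 1-separated subset of the unit sphere S_X of the Petty space and set D₀ = {(x,y,z) ∈ S_X : −1/3 ≤ z ≤ 1/3}. If S ∩ D₀ has exactly 9 elements, then S has at most 16 elements. -/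
open Real in
/-- Disjoint arcs on a circle: if the arcs of half-width `w i` centred at the angles `θ i` are
pairwise disjoint, then the half-widths sum to at most `π`. -/
theorem sum_le_pi_of_cos_sub_lt {ι : Type*} (s : Finset ι) (θ w : ι → ℝ)
    (hw : ∀ i ∈ s, 0 ≤ w i ∧ w i ≤ π / 2)
    (hsep : ∀ i ∈ s, ∀ j ∈ s, i ≠ j → cos (θ i - θ j) < cos (w i + w j)) :
    ∑ i ∈ s, w i ≤ π := by
  have : Fact (0 < 2 * π) := ⟨two_pi_pos⟩
  have hdisj : (s : Set ι).PairwiseDisjoint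
      fun i => Metric.closedBall (θ i : AddCircle (2 * π)) (w i) := by
    intro i hi j hj hij
    apply Metric.closedBall_disjoint_closedBall
    have h := hsep i hi j hj hij
    obtain ⟨d, hd, hd'⟩ : ∃ d : ℝ, ((θ i - θ j : ℝ) : AddCircle (2 * π)) = d ∧ |d| ≤ π := by
      refine ⟨(θ i - θ j : Real.Angle).toReal, ?_, Real.Angle.abs_toReal_le_pi _⟩
      exact (Real.Angle.coe_toReal ((θ i - θ j : ℝ) : Real.Angle)).symm
    have hcos : cos (θ i - θ j) = cos |d| := by
      rw [cos_abs, ← Real.Angle.cos_coe, ← Real.Angle.cos_coe]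
      exact congrArg Real.Angle.cos hd
    have hn : dist (θ i : AddCircle (2 * π)) (θ j) = |d| := by
      rw [dist_eq_norm, ← AddCircle.coe_sub, hd, AddCircle.norm_coe_eq_abs_iff _ two_pi_pos.ne',
        abs_of_pos two_pi_pos]
      linarith
    rw [hn]
    by_contra! hlt
    rw [hcos] at h
    refine absurd h (not_lt.2 (cos_le_cos_of_nonneg_of_le_pi (abs_nonneg d) ?_ hlt))
    linarith [(hw i hi).2, (hw j hj).2]
  have hvol := MeasureTheory.measure_biUnion_finset (μ := MeasureTheory.volume) hdisj
    fun i _ => Metric.isClosed_closedBall.measurableSet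
  have hle := MeasureTheory.measure_mono (μ := MeasureTheory.volume)
    (Set.subset_univ (⋃ i ∈ s, Metric.closedBall (θ i : AddCircle (2 * π)) (w i)))
  rw [hvol, AddCircle.measure_univ] at hle
  have hsum : ∑ i ∈ s, MeasureTheory.volume (Metric.closedBall (θ i : AddCircle (2 * π)) (w i))
      = ENNReal.ofReal (∑ i ∈ s, 2 * w i) := by
    rw [ENNReal.ofReal_sum_of_nonneg fun i hi => by linarith [(hw i hi).1]]
    refine Finset.sum_congr rfl fun i hi => ?_
    rw [AddCircle.volume_closedBall, min_eq_right]
    linarith [(hw i hi).2, pi_pos]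
  rw [hsum, ENNReal.ofReal_le_ofReal_iff two_pi_pos.le, ← Finset.mul_sum] at hle
  linarith

open Real in
theorem one_sub_two_mul_sq_le_cos {x : ℝ} (h0 : 0 ≤ x) (h2 : x ≤ 2) :
    1 - 2 * (x / 2 - (x / 2) ^ 3 / 6 + (x / 2) ^ 5 / 100) ^ 2 ≤ cos x := by
  have hb := sin_bound (x := x / 2) (by rw [abs_le]; constructor <;> linarith)
  rw [abs_of_nonneg (by linarith : 0 ≤ x / 2)] at hb
  have hs : 0 ≤ sin (x / 2) := sin_nonneg_of_nonneg_of_le_pi (by linarith) (by linarith [pi_gt_three])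
  have hu := (abs_le.1 hb).2
  have hc : cos x = 1 - 2 * sin (x / 2) ^ 2 := by
    rw [← mul_div_cancel₀ x (two_ne_zero' ℝ), cos_two_mul, cos_sq']; ring_nf
  rw [hc]
  gcongr
  linarith

/-- The Euclidean length of the horizontal part of a point. -/
noncomputable def horizRadius (a : ℝ × ℝ × ℝ) : ℝ := Real.sqrt (a.1 ^ 2 + a.2.1 ^ 2)

/-- The polar angle of the horizontal part of a point. -/
noncomputable def horizAngle (a : ℝ × ℝ × ℝ) : ℝ := Complex.arg ⟨a.1, a.2.1⟩

theorem horizRadius_nonneg (a : ℝ × ℝ × ℝ) : 0 ≤ horizRadius a := Real.sqrt_nonneg _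

theorem horizRadius_eq_of_mem {a : ℝ × ℝ × ℝ} (ha : a ∈ pettySphere) :
    horizRadius a = 1 - |a.2.2| := by
  have : horizRadius a + |a.2.2| = 1 := ha
  linarith

theorem pettyDist_eq_s12 (a b : ℝ × ℝ × ℝ) :
    pettyDist a b = Real.sqrt (horizRadius a ^ 2 + horizRadius b ^ 2 -
      2 * horizRadius a * horizRadius b * Real.cos (horizAngle a - horizAngle b)) +
      |a.2.2 - b.2.2| := by
  have hx : ∀ c : ℝ × ℝ × ℝ, c.1 = horizRadius c * Real.cos (horizAngle c) ∧
      c.2.1 = horizRadius c * Real.sin (horizAngle c) := by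
    intro c
    have hr : horizRadius c = ‖(⟨c.1, c.2.1⟩ : ℂ)‖ := by
      rw [Complex.norm_eq_sqrt_sq_add_sq]; rfl
    rw [hr]
    exact ⟨(Complex.norm_mul_cos_arg ⟨c.1, c.2.1⟩).symm, (Complex.norm_mul_sin_arg ⟨c.1, c.2.1⟩).symm⟩
  have h : (a - b).1 ^ 2 + (a - b).2.1 ^ 2 = horizRadius a ^ 2 + horizRadius b ^ 2 -
      2 * horizRadius a * horizRadius b * Real.cos (horizAngle a - horizAngle b) := by
    rw [Real.cos_sub, Prod.fst_sub, Prod.snd_sub, Prod.fst_sub, (hx a).1, (hx a).2, (hx b).1,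
      (hx b).2]
    linear_combination (horizRadius a) ^ 2 * Real.sin_sq_add_cos_sq (horizAngle a) +
      (horizRadius b) ^ 2 * Real.sin_sq_add_cos_sq (horizAngle b)
  unfold pettyDist pettyNorm
  rw [h]
  rfl

theorem sq_le_of_one_le_pettyDist {a b : ℝ × ℝ × ℝ} {v : ℝ} (h : 1 ≤ pettyDist a b)
    (hv : |a.2.2 - b.2.2| ≤ 1 - v) (hv0 : 0 < v) :
    v ^ 2 ≤ horizRadius a ^ 2 + horizRadius b ^ 2 -
      2 * horizRadius a * horizRadius b * Real.cos (horizAngle a - horizAngle b) := by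
  rw [pettyDist_eq_s12] at h
  exact (Real.le_sqrt' hv0).1 (by linarith)

theorem abs_sub_eq_of_mul_nonneg {a b : ℝ × ℝ × ℝ} (ha : a ∈ pettySphere) (hb : b ∈ pettySphere)
    (hz : 0 ≤ a.2.2 * b.2.2) : |a.2.2 - b.2.2| = |horizRadius a - horizRadius b| := by
  rw [horizRadius_eq_of_mem ha, horizRadius_eq_of_mem hb]
  rcases mul_nonneg_iff.1 hz with ⟨h1, h2⟩ | ⟨h1, h2⟩
  · rw [abs_of_nonneg h1, abs_of_nonneg h2, abs_sub_comm]; congr 1; ring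
  · rw [abs_of_nonpos h1, abs_of_nonpos h2]; congr 1; ring

theorem cos_le_of_same_side {a b : ℝ × ℝ × ℝ} (ha : a ∈ pettySphere) (hb : b ∈ pettySphere)
    (hz : 0 ≤ a.2.2 * b.2.2) (h : 1 ≤ pettyDist a b) (h' : 1 ≤ pettyDist b a) {q p : ℝ}
    (hq : 1 / 2 ≤ q) (hp : p ≤ 1) (hqa : q ≤ horizRadius a) (hqb : q ≤ horizRadius b)
    (hap : horizRadius a ≤ p) (hbp : horizRadius b ≤ p) :
    Real.cos (horizAngle a - horizAngle b) ≤ 1 - 1 / p + (2 * p - 1) / (2 * p * q) := by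
  wlog hba : horizRadius b ≤ horizRadius a generalizing a b
  · rw [← Real.cos_neg, neg_sub]
    exact this hb ha (by rwa [mul_comm]) h' h hqb hqa hbp hap (le_of_not_ge hba)
  have hd := abs_sub_eq_of_mul_nonneg ha hb hz
  rw [abs_of_nonneg (by linarith : 0 ≤ horizRadius a - horizRadius b)] at hd
  have h1 := sq_le_of_one_le_pettyDist (v := 1 - (horizRadius a - horizRadius b)) h
    (by rw [hd]; linarith) (by linarith)
  generalize horizRadius a = r at *
  generalize horizRadius b = t at *
  generalize Real.cos _ = c at *
  have hr : 0 < r := by linarith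
  have ht : 0 < t := by linarith
  have hq0 : 0 < q := by linarith
  have hp0 : 0 < p := by linarith
  have h2 : c ≤ 1 - 1 / r + (2 * r - 1) / (2 * r * t) := by
    have : 1 - 1 / r + (2 * r - 1) / (2 * r * t) = (2 * t * (r - 1) + (2 * r - 1)) / (2 * r * t) := by
      field_simp
    rw [this, le_div_iff₀ (by positivity)]
    nlinarith
  have h3 : (2 * r - 1) / (2 * r * t) ≤ (2 * r - 1) / (2 * r * q) := by
    apply div_le_div_of_nonneg_left (by linarith) (by positivity)
    gcongr
  have h4 : ∀ s : ℝ, 0 < s → 1 - 1 / s + (2 * s - 1) / (2 * s * q) =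
      1 + 1 / q - 1 / s * (1 + 1 / (2 * q)) := by
    intro s hs
    field_simp
    ring
  rw [h4 p hp0]
  rw [← sub_nonneg] at h3
  have h5 : 1 / p ≤ 1 / r := by gcongr
  have h6 : 1 / p * (1 + 1 / (2 * q)) ≤ 1 / r * (1 + 1 / (2 * q)) := by gcongr
  linarith [h4 r hr]

theorem cos_le_of_one_le_pettyDist {a b : ℝ × ℝ × ℝ} (ha : a ∈ pettySphere) (hb : b ∈ pettySphere)
    (h : 1 ≤ pettyDist a b) {p q : ℝ} (hp : 1 / 2 < p) (hq : 1 / 2 < q)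
    (hpa : p ≤ horizRadius a) (hqb : q ≤ horizRadius b) :
    Real.cos (horizAngle a - horizAngle b) ≤ 1 - 2 * (1 - 1 / (2 * p)) * (1 - 1 / (2 * q)) := by
  have ha' := horizRadius_eq_of_mem ha
  have hb' := horizRadius_eq_of_mem hb
  have h1 := sq_le_of_one_le_pettyDist (v := horizRadius a + horizRadius b - 1) h
    (by have := abs_sub a.2.2 b.2.2; linarith) (by linarith)
  generalize horizRadius a = r at *
  generalize horizRadius b = t at *
  generalize Real.cos _ = c at *
  have hr : 0 < r := by linarith
  have ht : 0 < t := by linarith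
  have h2 : c ≤ 1 - 2 * (1 - 1 / (2 * r)) * (1 - 1 / (2 * t)) := by
    have : 1 - 2 * (1 - 1 / (2 * r)) * (1 - 1 / (2 * t)) =
        (2 * (r + t) - 1 - 2 * r * t) / (2 * r * t) := by
      field_simp
      ring
    rw [this, le_div_iff₀ (by positivity)]
    nlinarith
  have h3 : 1 / (2 * r) ≤ 1 / (2 * p) := by gcongr
  have h4 : 1 / (2 * t) ≤ 1 / (2 * q) := by gcongr
  have h5 : 1 / (2 * p) ≤ 1 := by rw [div_le_one (by linarith)]; linarith
  have h6 : 1 / (2 * q) ≤ 1 := by rw [div_le_one (by linarith)]; linarith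
  nlinarith [mul_le_mul (sub_le_sub_left h3 1) (sub_le_sub_left h4 1) (by linarith) (by linarith)]

theorem cos_neg_of_same_side {a b : ℝ × ℝ × ℝ} (ha : a ∈ pettySphere) (hb : b ∈ pettySphere)
    (hz : 0 ≤ a.2.2 * b.2.2) (h : 1 ≤ pettyDist a b) (h' : 1 ≤ pettyDist b a)
    (hra : horizRadius a ∈ Set.Ico (1 / 2) (2 / 3)) (hrb : horizRadius b ∈ Set.Ico (1 / 2) (2 / 3)) :
    Real.cos (horizAngle a - horizAngle b) < 0 := by
  have hp : max (horizRadius a) (horizRadius b) < 2 / 3 := max_lt hra.2 hrb.2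
  have hp' : 1 / 2 ≤ max (horizRadius a) (horizRadius b) := le_max_of_le_left hra.1
  refine (cos_le_of_same_side ha hb hz h h' le_rfl (by linarith) hra.1 hrb.1 (le_max_left _ _)
    (le_max_right _ _)).trans_lt ?_
  generalize max (horizRadius a) (horizRadius b) = p at *
  have hp0 : 0 < p := by linarith
  have : 1 - 1 / p + (2 * p - 1) / (2 * p * (1 / 2)) = (3 * p - 2) / p := by
    field_simp
    ring
  rw [this]
  exact div_neg_of_neg_of_pos (by linarith) hp0

theorem card_le_three_of_cos_neg {ι : Type*} (s : Finset ι) (θ : ι → ℝ)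
    (h : ∀ i ∈ s, ∀ j ∈ s, i ≠ j → Real.cos (θ i - θ j) < 0) : s.card ≤ 3 := by
  classical
  by_contra! hcard
  have hne : s.offDiag.Nonempty := by
    obtain ⟨i, hi, j, hj, hij⟩ := Finset.one_lt_card.1 (by omega : 1 < s.card)
    exact ⟨(i, j), Finset.mem_offDiag.2 ⟨hi, hj, hij⟩⟩
  obtain ⟨⟨i₀, j₀⟩, hmem, hmax⟩ := Finset.exists_max_image s.offDiag
    (fun x => Real.cos (θ x.1 - θ x.2)) hne
  obtain ⟨hi₀, hj₀, hij₀⟩ := Finset.mem_offDiag.1 hmem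
  have hneg := h i₀ hi₀ j₀ hj₀ hij₀
  set c := Real.cos (θ i₀ - θ j₀)
  have hc1 : -1 ≤ c := Real.neg_one_le_cos _
  have hlt : Real.pi / 2 < Real.arccos c := by
    by_contra! hle
    exact absurd (Real.arccos_le_pi_div_two.1 hle) (not_le.2 hneg)
  obtain ⟨x, hx1, hx2⟩ := exists_between hlt
  have hpi := Real.pi_pos
  have hcx : c < Real.cos x := by
    rw [← Real.cos_arccos hc1 (by linarith)]
    exact Real.cos_lt_cos_of_nonneg_of_le_pi (by linarith) (Real.arccos_le_pi c) hx2
  have hsum := sum_le_pi_of_cos_sub_lt s θ (fun _ => x / 2)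
    (fun i _ => ⟨by linarith, by linarith [Real.arccos_le_pi c]⟩) fun i hi j hj hij => by
      rw [add_halves]
      exact (hmax (i, j) (Finset.mem_offDiag.2 ⟨hi, hj, hij⟩)).trans_lt hcx
  rw [Finset.sum_const, nsmul_eq_mul] at hsum
  have : (4 : ℝ) ≤ s.card := by exact_mod_cast hcard
  nlinarith

/-- Three points of the sphere strictly above height `1/3` and a set of middle points on the same
side with horizontal radii at most `p` give disjoint arcs of half-widths `wt` and `wm`. -/
theorem arc_bound_of_three_caps {T M : Finset (ℝ × ℝ × ℝ)} {S : Set (ℝ × ℝ × ℝ)}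
    (hsep : OneSeparated S) (hS : S ⊆ pettySphere) (hTS : ↑T ⊆ S) (hMS : ↑M ⊆ S)
    (hz : ∀ a ∈ T ∪ M, ∀ b ∈ T ∪ M, 0 ≤ a.2.2 * b.2.2)
    (hT : ∀ a ∈ T, horizRadius a ∈ Set.Ico (1 / 2) (2 / 3)) (hT3 : T.card = 3)
    {p : ℝ} (hp : p ≤ 1) (hM : ∀ a ∈ M, horizRadius a ∈ Set.Icc (2 / 3) p)
    {wt wm : ℝ} (hwt : 0 ≤ wt) (hwm : 0 ≤ wm) (hwm' : wm ≤ 3 / 2)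
    (htt : wt + wt ≤ 157 / 100)
    (htm : 1 - 1 / p + (2 * p - 1) / (2 * p * (1 / 2)) < Real.cos (wt + wm))
    (hmm : 1 - 1 / p + (2 * p - 1) / (2 * p * (2 / 3)) < Real.cos (wm + wm)) :
    3 * wt + M.card * wm ≤ Real.pi := by
  classical
  have hdisj : Disjoint T M := by
    rw [Finset.disjoint_left]
    intro a ha ha'
    linarith [(hT a ha).2, (hM a ha').1]
  have hmem : ∀ a ∈ T ∪ M, a ∈ S := fun a ha =>
    (Finset.mem_union.1 ha).elim (fun h => hTS h) fun h => hMS h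
  have hpi := Real.pi_gt_d2
  have key := sum_le_pi_of_cos_sub_lt (T ∪ M) horizAngle
    (fun a => if a ∈ T then wt else wm)
    (fun a _ => by
      split_ifs
      · exact ⟨hwt, by linarith⟩
      · exact ⟨hwm, by linarith⟩) fun a ha b hb hab => by
      have hzab := hz a ha b hb
      have h1 := hsep a (hmem a ha) b (hmem b hb) hab
      have h2 := hsep b (hmem b hb) a (hmem a ha) hab.symm
      have hSa := hS (hmem a ha)
      have hSb := hS (hmem b hb)
      have hMr : ∀ c ∈ T ∪ M, c ∉ T → horizRadius c ∈ Set.Icc (2 / 3) p := fun c hc hcT =>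
        hM c ((Finset.mem_union.1 hc).resolve_left hcT)
      by_cases haT : a ∈ T <;> by_cases hbT : b ∈ T <;> simp only [haT, hbT, if_true, if_false]
      · refine (cos_neg_of_same_side hSa hSb hzab h1 h2 (hT a haT) (hT b hbT)).trans_le ?_
        exact Real.cos_nonneg_of_neg_pi_div_two_le_of_le (by linarith) (by linarith)
      · obtain ⟨ha1, ha2⟩ := hT a haT
        obtain ⟨hb1, hb2⟩ := hMr b hb hbT
        exact (cos_le_of_same_side hSa hSb hzab h1 h2 le_rfl hp ha1 (by linarith) (by linarith)
          hb2).trans_lt htm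
      · obtain ⟨ha1, ha2⟩ := hMr a ha haT
        obtain ⟨hb1, hb2⟩ := hT b hbT
        rw [add_comm]
        exact (cos_le_of_same_side hSa hSb hzab h1 h2 le_rfl hp (by linarith) hb1 ha2
          (by linarith)).trans_lt htm
      · obtain ⟨ha1, ha2⟩ := hMr a ha haT
        obtain ⟨hb1, hb2⟩ := hMr b hb hbT
        exact (cos_le_of_same_side hSa hSb hzab h1 h2 (by norm_num) hp ha1 hb1 ha2 hb2).trans_lt hmm
  rw [Finset.sum_union hdisj, Finset.sum_congr rfl (fun a ha => if_pos ha),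
    Finset.sum_congr (rfl : M = M) (fun a ha => if_neg (Finset.disjoint_right.1 hdisj ha)),
    Finset.sum_const, Finset.sum_const, hT3] at key
  simpa using key

theorem middle_card_bounds {T M : Finset (ℝ × ℝ × ℝ)} {S : Set (ℝ × ℝ × ℝ)}
    (hsep : OneSeparated S) (hS : S ⊆ pettySphere) (hTS : ↑T ⊆ S) (hMS : ↑M ⊆ S)
    (hz : ∀ a ∈ T ∪ M, ∀ b ∈ T ∪ M, 0 ≤ a.2.2 * b.2.2)
    (hT : ∀ a ∈ T, horizRadius a ∈ Set.Ico (1 / 2) (2 / 3)) (hT3 : T.card = 3)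
    (hM : ∀ a ∈ M, 2 / 3 ≤ horizRadius a) :
    (M.filter fun a => horizRadius a ≤ 0.76).card ≤ 1 ∧
    (M.filter fun a => horizRadius a ≤ 0.795).card ≤ 2 ∧
    (M.filter fun a => horizRadius a ≤ 0.845).card ≤ 3 := by
  classical
  have bound : ∀ (k : ℕ) (p wt wm : ℝ), p ≤ 1 → 0 ≤ wt → 0 ≤ wm → wm ≤ 3 / 2 →
      wt + wt ≤ 157 / 100 →
      1 - 1 / p + (2 * p - 1) / (2 * p * (1 / 2)) < Real.cos (wt + wm) →
      1 - 1 / p + (2 * p - 1) / (2 * p * (2 / 3)) < Real.cos (wm + wm) →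
      3.1416 < 3 * wt + (k + 1) * wm → (M.filter fun a => horizRadius a ≤ p).card ≤ k := by
    intro k p wt wm hp hwt hwm hwm' htt htm hmm hk
    by_contra! hcard
    have hsub := Finset.union_subset_union_right (s := T)
      (Finset.filter_subset (fun a => horizRadius a ≤ p) M)
    have h := arc_bound_of_three_caps hsep hS hTS
      (fun a ha => hMS (Finset.filter_subset _ _ ha))
      (fun a ha b hb => hz a (hsub ha) b (hsub hb)) hT hT3 hp
      (fun a ha => ⟨hM a (Finset.mem_filter.1 ha).1, (Finset.mem_filter.1 ha).2⟩)
      hwt hwm hwm' htt htm hmm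
    have hc : (k : ℝ) + 1 ≤ (M.filter fun a => horizRadius a ≤ p).card := by exact_mod_cast hcard
    have := mul_le_mul_of_nonneg_right hc hwm
    linarith [Real.pi_lt_d4]
  refine ⟨bound 1 _ 0.785 0.394 ?_ ?_ ?_ ?_ ?_ ?_ ?_ ?_,
    bound 2 _ 0.524 0.524 ?_ ?_ ?_ ?_ ?_ ?_ ?_ ?_,
    bound 3 _ 0.31 0.555 ?_ ?_ ?_ ?_ ?_ ?_ ?_ ?_⟩
  all_goals first
    | norm_num; done
    | exact lt_of_lt_of_le (by norm_num) (one_sub_two_mul_sq_le_cos (by norm_num) (by norm_num))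

/-- Half-width of the arc reserved for a middle point of horizontal radius `r`. -/
noncomputable def middleArc (r : ℝ) : ℝ :=
  0.416 - (if r ≤ 0.845 then 0.039 else 0) - (if r ≤ 0.795 then 0.030 else 0) -
    (if r ≤ 0.76 then 0.117 else 0)

theorem middleArc_cases {r : ℝ} (hr : 2 / 3 ≤ r) :
    (2 / 3 ≤ r ∧ middleArc r = 0.230) ∨ (0.76 ≤ r ∧ middleArc r = 0.347) ∨
      (0.795 ≤ r ∧ middleArc r = 0.377) ∨ (0.845 ≤ r ∧ middleArc r = 0.416) := by
  unfold middleArc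
  split_ifs <;> norm_num at * <;> linarith

theorem sum_middleArc_le_pi {N : Finset (ℝ × ℝ × ℝ)} (hsep : OneSeparated ↑N)
    (hN : ↑N ⊆ pettySphere) (hr : ∀ a ∈ N, 2 / 3 ≤ horizRadius a) :
    ∑ a ∈ N, middleArc (horizRadius a) ≤ Real.pi := by
  refine sum_le_pi_of_cos_sub_lt N horizAngle _ (fun a ha => ?_) fun a ha b hb hab => ?_
  · have := Real.pi_gt_three
    rcases middleArc_cases (hr a ha) with ⟨-, h⟩ | ⟨-, h⟩ | ⟨-, h⟩ | ⟨-, h⟩ <;> rw [h] <;>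
      constructor <;> linarith
  · have hd := hsep a ha b hb hab
    rcases middleArc_cases (hr a ha) with ⟨ha', h⟩ | ⟨ha', h⟩ | ⟨ha', h⟩ | ⟨ha', h⟩ <;>
    rcases middleArc_cases (hr b hb) with ⟨hb', h'⟩ | ⟨hb', h'⟩ | ⟨hb', h'⟩ | ⟨hb', h'⟩ <;>
    rw [h, h'] <;>
    exact (cos_le_of_one_le_pettyDist (hN ha) (hN hb) hd (by norm_num) (by norm_num) ha' hb').trans_lt
      (lt_of_lt_of_le (by norm_num) (one_sub_two_mul_sq_le_cos (by norm_num) (by norm_num)))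

/-- The arcs of nine middle points do not fit on the circle when both caps carry three points of
horizontal radius at least `1/2`. -/
theorem not_three_caps_on_both_sides {S : Set (ℝ × ℝ × ℝ)} (hsep : OneSeparated S)
    (hS : S ⊆ pettySphere) {U L N : Finset (ℝ × ℝ × ℝ)} (hUS : ↑U ⊆ S) (hLS : ↑L ⊆ S)
    (hNS : ↑N ⊆ S) (hU : ∀ a ∈ U, 0 ≤ a.2.2 ∧ horizRadius a ∈ Set.Ico (1 / 2) (2 / 3))
    (hL : ∀ a ∈ L, a.2.2 ≤ 0 ∧ horizRadius a ∈ Set.Ico (1 / 2) (2 / 3))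
    (hN : ∀ a ∈ N, 2 / 3 ≤ horizRadius a) (hU3 : U.card = 3) (hL3 : L.card = 3)
    (hN9 : N.card = 9) : False := by
  classical
  have hup := middle_card_bounds (T := U) (M := N.filter fun a => 0 ≤ a.2.2) hsep hS hUS
    (fun a ha => hNS (Finset.filter_subset _ _ ha))
    (by
      have h : ∀ a ∈ U ∪ N.filter fun a => 0 ≤ a.2.2, 0 ≤ a.2.2 := fun a ha =>
        (Finset.mem_union.1 ha).elim (fun h => (hU a h).1) fun h => (Finset.mem_filter.1 h).2
      exact fun a ha b hb => mul_nonneg (h a ha) (h b hb))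
    (fun a ha => (hU a ha).2) hU3 fun a ha => hN a (Finset.mem_filter.1 ha).1
  have hlow := middle_card_bounds (T := L) (M := N.filter fun a => ¬ 0 ≤ a.2.2) hsep hS hLS
    (fun a ha => hNS (Finset.filter_subset _ _ ha))
    (by
      have h : ∀ a ∈ L ∪ N.filter fun a => ¬ 0 ≤ a.2.2, a.2.2 ≤ 0 := fun a ha =>
        (Finset.mem_union.1 ha).elim (fun h => (hL a h).1)
          fun h => (not_le.1 (Finset.mem_filter.1 h).2).le
      exact fun a ha b hb => mul_nonneg_of_nonpos_of_nonpos (h a ha) (h b hb))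
    (fun a ha => (hL a ha).2) hL3 fun a ha => hN a (Finset.mem_filter.1 ha).1
  have hsplit : ∀ p : ℝ, (N.filter fun a => horizRadius a ≤ p).card =
      ((N.filter fun a => 0 ≤ a.2.2).filter fun a => horizRadius a ≤ p).card +
      ((N.filter fun a => ¬ 0 ≤ a.2.2).filter fun a => horizRadius a ≤ p).card := by
    intro p
    rw [Finset.filter_comm, Finset.filter_comm (s := N) (p := fun a => ¬ 0 ≤ a.2.2),
      Finset.card_filter_add_card_filter_not]
  have hsum := sum_middleArc_le_pi (fun a ha b hb => hsep a (hNS ha) b (hNS hb))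
    (hNS.trans hS) hN
  have hind : ∀ p c : ℝ, ∑ a ∈ N, (if horizRadius a ≤ p then c else 0) =
      (N.filter fun a => horizRadius a ≤ p).card * c := by
    intro p c
    rw [← Finset.sum_filter, Finset.sum_const, nsmul_eq_mul]
  simp only [middleArc, Finset.sum_sub_distrib, hind, Finset.sum_const, hN9, nsmul_eq_mul] at hsum
  have h1 : ((N.filter fun a => horizRadius a ≤ 0.76).card : ℝ) ≤ 2 := by
    have := hsplit 0.76
    exact_mod_cast (by omega : (N.filter fun a => horizRadius a ≤ 0.76).card ≤ 2)
  have h2 : ((N.filter fun a => horizRadius a ≤ 0.795).card : ℝ) ≤ 4 := by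
    have := hsplit 0.795
    exact_mod_cast (by omega : (N.filter fun a => horizRadius a ≤ 0.795).card ≤ 4)
  have h3 : ((N.filter fun a => horizRadius a ≤ 0.845).card : ℝ) ≤ 6 := by
    have := hsplit 0.845
    exact_mod_cast (by omega : (N.filter fun a => horizRadius a ≤ 0.845).card ≤ 6)
  push_cast at hsum
  linarith [Real.pi_lt_d4]

theorem encard_le_one_of_horizRadius_lt {C : Set (ℝ × ℝ × ℝ)} (hsep : OneSeparated C)
    (hC : C ⊆ pettySphere) (hz : ∀ a ∈ C, ∀ b ∈ C, 0 ≤ a.2.2 * b.2.2)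
    (hr : ∀ a ∈ C, horizRadius a < 1 / 2) : C.encard ≤ 1 := by
  rw [Set.encard_le_one_iff]
  intro a b ha hb
  by_contra hab
  have h := hsep a ha b hb hab
  rw [pettyDist_eq_s12, abs_sub_eq_of_mul_nonneg (hC ha) (hC hb) (hz a ha b hb)] at h
  have hs : Real.sqrt (horizRadius a ^ 2 + horizRadius b ^ 2 -
      2 * horizRadius a * horizRadius b * Real.cos (horizAngle a - horizAngle b)) ≤
      horizRadius a + horizRadius b := by
    rw [Real.sqrt_le_left (add_nonneg (horizRadius_nonneg a) (horizRadius_nonneg b))]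
    nlinarith [mul_nonneg (horizRadius_nonneg a) (horizRadius_nonneg b),
      Real.neg_one_le_cos (horizAngle a - horizAngle b)]
  have := hr a ha
  have := hr b hb
  rcases abs_cases (horizRadius a - horizRadius b) with ⟨h', -⟩ | ⟨h', -⟩ <;> linarith

theorem exists_finset_subset_card_eq {α : Type*} {s : Set α} {n : ℕ} (h : (n : ℕ∞) ≤ s.encard) :
    ∃ T : Finset α, ↑T ⊆ s ∧ T.card = n := by
  obtain ⟨t, hts, ht⟩ := Set.exists_subset_encard_eq h
  have hfin : t.Finite := Set.finite_of_encard_eq_coe ht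
  refine ⟨hfin.toFinset, by simpa using hts, ?_⟩
  rw [hfin.encard_eq_coe_toFinset_card] at ht
  exact_mod_cast ht

theorem encard_le_three_of_horizRadius_mem {C : Set (ℝ × ℝ × ℝ)} (hsep : OneSeparated C)
    (hC : C ⊆ pettySphere) (hz : ∀ a ∈ C, ∀ b ∈ C, 0 ≤ a.2.2 * b.2.2)
    (hr : ∀ a ∈ C, horizRadius a ∈ Set.Ico (1 / 2) (2 / 3)) : C.encard ≤ 3 := by
  by_contra! h
  obtain ⟨T, hT, hT4⟩ := exists_finset_subset_card_eq (n := 4) (Order.add_one_le_of_lt h)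
  have := card_le_three_of_cos_neg T horizAngle fun a ha b hb hab =>
    cos_neg_of_same_side (hC (hT ha)) (hC (hT hb)) (hz a (hT ha) b (hT hb))
      (hsep a (hT ha) b (hT hb) hab) (hsep b (hT hb) a (hT ha) hab.symm) (hr a (hT ha))
      (hr b (hT hb))
  omega

theorem OneSeparated.mono {S C : Set (ℝ × ℝ × ℝ)} (hsep : OneSeparated S) (hCS : C ⊆ S) :
    OneSeparated C :=
  fun a ha b hb => hsep a (hCS ha) b (hCS hb)

/-- for a 1-separated subset S of the Petty unit sphere,
if |S ∩ D₀| = 9 then |S| ≤ 16. -/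
theorem oneSeparated_middle_nine (S : Set (ℝ × ℝ × ℝ)) (hsep : OneSeparated S)
    (hS : S ⊆ pettySphere)
    (h0 : (S ∩ {a ∈ pettySphere | -(1/3) ≤ a.2.2 ∧ a.2.2 ≤ 1/3}).encard = 9) :
    S.encard ≤ 16 := by
  set D := S ∩ {a ∈ pettySphere | -(1/3) ≤ a.2.2 ∧ a.2.2 ≤ 1/3}
  set U := {a ∈ S | 1 / 3 < a.2.2 ∧ 1 / 2 ≤ horizRadius a}
  set U' := {a ∈ S | 1 / 3 < a.2.2 ∧ horizRadius a < 1 / 2}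
  set L := {a ∈ S | a.2.2 < -(1 / 3) ∧ 1 / 2 ≤ horizRadius a}
  set L' := {a ∈ S | a.2.2 < -(1 / 3) ∧ horizRadius a < 1 / 2}
  have hcover : S ⊆ D ∪ (U ∪ L) ∪ (U' ∪ L') := by
    intro a ha
    rcases lt_or_ge (1 / 3) a.2.2 with h1 | h1
    · rcases lt_or_ge (horizRadius a) (1 / 2) with h2 | h2
      · exact Or.inr (Or.inl ⟨ha, h1, h2⟩)
      · exact Or.inl (Or.inr (Or.inl ⟨ha, h1, h2⟩))
    · rcases lt_or_ge a.2.2 (-(1 / 3)) with h3 | h3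
      · rcases lt_or_ge (horizRadius a) (1 / 2) with h2 | h2
        · exact Or.inr (Or.inr ⟨ha, h3, h2⟩)
        · exact Or.inl (Or.inr (Or.inr ⟨ha, h3, h2⟩))
      · exact Or.inl (Or.inl ⟨ha, hS ha, h3, h1⟩)
  have hUr : ∀ a ∈ U, horizRadius a ∈ Set.Ico (1 / 2) (2 / 3) := fun a ha =>
    ⟨ha.2.2, by linarith [horizRadius_eq_of_mem (hS ha.1), le_abs_self a.2.2, ha.2.1]⟩
  have hLr : ∀ a ∈ L, horizRadius a ∈ Set.Ico (1 / 2) (2 / 3) := fun a ha =>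
    ⟨ha.2.2, by linarith [horizRadius_eq_of_mem (hS ha.1), neg_le_abs a.2.2, ha.2.1]⟩
  have hpos : ∀ a b : ℝ × ℝ × ℝ, 1 / 3 < a.2.2 → 1 / 3 < b.2.2 → 0 ≤ a.2.2 * b.2.2 :=
    fun a b ha hb => mul_nonneg (by linarith) (by linarith)
  have hneg : ∀ a b : ℝ × ℝ × ℝ, a.2.2 < -(1 / 3) → b.2.2 < -(1 / 3) → 0 ≤ a.2.2 * b.2.2 :=
    fun a b ha hb => mul_nonneg_of_nonpos_of_nonpos (by linarith) (by linarith)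
  have hUS : U ⊆ S := Set.sep_subset _ _
  have hLS : L ⊆ S := Set.sep_subset _ _
  have hUS' : U' ⊆ S := Set.sep_subset _ _
  have hLS' : L' ⊆ S := Set.sep_subset _ _
  have hU3 : U.encard ≤ 3 := encard_le_three_of_horizRadius_mem (hsep.mono hUS) (hUS.trans hS)
    (fun a ha b hb => hpos a b ha.2.1 hb.2.1) hUr
  have hL3 : L.encard ≤ 3 := encard_le_three_of_horizRadius_mem (hsep.mono hLS) (hLS.trans hS)
    (fun a ha b hb => hneg a b ha.2.1 hb.2.1) hLr
  have hU1 : U'.encard ≤ 1 := encard_le_one_of_horizRadius_lt (hsep.mono hUS') (hUS'.trans hS)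
    (fun a ha b hb => hpos a b ha.2.1 hb.2.1) fun a ha => ha.2.2
  have hL1 : L'.encard ≤ 1 := encard_le_one_of_horizRadius_lt (hsep.mono hLS') (hLS'.trans hS)
    (fun a ha b hb => hneg a b ha.2.1 hb.2.1) fun a ha => ha.2.2
  have hUL : U.encard ≤ 2 ∨ L.encard ≤ 2 := by
    by_contra! h
    obtain ⟨TU, hTU, hTU3⟩ := exists_finset_subset_card_eq (n := 3) (Order.add_one_le_of_lt h.1)
    obtain ⟨TL, hTL, hTL3⟩ := exists_finset_subset_card_eq (n := 3) (Order.add_one_le_of_lt h.2)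
    obtain ⟨N, hN, hN9⟩ := exists_finset_subset_card_eq (n := 9) h0.ge
    refine not_three_caps_on_both_sides hsep hS (hTU.trans hUS) (hTL.trans hLS)
      (hN.trans Set.inter_subset_left)
      (fun a ha => ⟨by linarith [(hTU ha).2.1], hUr a (hTU ha)⟩)
      (fun a ha => ⟨by linarith [(hTL ha).2.1], hLr a (hTL ha)⟩) (fun a ha => ?_) hTU3 hTL3 hN9
    obtain ⟨haS, -, h1, h2⟩ := hN ha
    linarith [horizRadius_eq_of_mem (hS haS), abs_le.2 ⟨h1, h2⟩]
  have hUL5 : U.encard + L.encard ≤ 5 := by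
    rcases hUL with h | h
    · exact (add_le_add h hL3).trans (by norm_num)
    · exact (add_le_add hU3 h).trans (by norm_num)
  calc S.encard ≤ (D ∪ (U ∪ L) ∪ (U' ∪ L')).encard := Set.encard_le_encard hcover
    _ ≤ D.encard + (U ∪ L).encard + (U' ∪ L').encard :=
        (Set.encard_union_le _ _).trans (add_le_add_left (Set.encard_union_le _ _) _)
    _ ≤ 9 + 5 + (1 + 1) := add_le_add
        (add_le_add h0.le ((Set.encard_union_le _ _).trans hUL5))
        ((Set.encard_union_le _ _).trans (add_le_add hU1 hL1))
    _ = 16 := by norm_num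
end
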